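/- Let σ ∈ S(ℝ^d₊) with continuous extension σ̄ to [0,∞)^d, and let f, g ∈ 𝒮(ℝ^d) be Schwartz functions. Set f_k = ∫_{ℝ^d} f(x) h_k(x) dx and g_k = ∫_{ℝ^d} g(x) h_k(x) dx for k ∈ ℕ₀^d. Then ∫_{ℝ^{2d}} σ̄(2(x₁²+ξ₁²), …, 2(x_d²+ξ_d²)) · W̃(f,g)(x,ξ) dx dξ = 2^{−d} (2π)^{d/2} ∑_{k∈ℕ₀^d} (−1)^{|k|} f_k g_k ∫_{ℝ^d₊} σ(ρ) 𝓛_k(ρ) dρ, where the series on the right converges absolutely. (This is the diagonalization of the Weyl pseudo-differential operator with radial symbol in the Hermite basis.) -/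

import Mathlib

open MeasureTheory Filter Finset

noncomputable section

def Rpos (d : ℕ) : Set (Fin d → ℝ) := {x | ∀ i, 0 < x i}

def pd {d : ℕ} (i : Fin d) (f : (Fin d → ℝ) → ℂ) : (Fin d → ℝ) → ℂ :=
  fun x => fderiv ℝ f x (Pi.single i 1)

def mderiv {d : ℕ} (p : Fin d → ℕ) (f : (Fin d → ℝ) → ℂ) : (Fin d → ℝ) → ℂ :=
  ((List.ofFn fun i : Fin d => (fun g => (pd i)^[p i] g)).foldr (· ∘ ·) id) f

/-- The space `S(ℝ^d₊)`. -/
def IsSPlus {d : ℕ} (f : (Fin d → ℝ) → ℂ) : Prop :=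
  ContDiffOn ℝ (⊤ : ℕ∞) f (Rpos d) ∧
  (∀ p : Fin d → ℕ, ∃ g : (Fin d → ℝ) → ℂ,
    ContinuousOn g {x | ∀ i, 0 ≤ x i} ∧ ∀ x ∈ Rpos d, g x = mderiv p f x) ∧
  (∀ k p : Fin d → ℕ, ∃ C : ℝ, ∀ x ∈ Rpos d,
    (∏ i, x i ^ k i) * ‖mderiv p f x‖ ≤ C)

/-- Hermite polynomial `H_j`. -/
def hermP (j : ℕ) (t : ℝ) : ℝ :=
  (-1)^j * Real.exp (t^2) * (deriv^[j] fun s => Real.exp (-(s^2))) t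

/-- Hermite function `h_j`. -/
def hermFun (j : ℕ) (t : ℝ) : ℝ :=
  ((2:ℝ)^j * (j.factorial : ℝ) * Real.sqrt Real.pi) ^ (-(1/2 : ℝ)) *
    Real.exp (-(t^2)/2) * hermP j t

def HermFun {d : ℕ} (n : Fin d → ℕ) (x : Fin d → ℝ) : ℝ := ∏ l, hermFun (n l) (x l)

/-- Laguerre polynomial of order `0`. -/
def lag0 (j : ℕ) (t : ℝ) : ℝ :=
  ∑ k ∈ Finset.range (j+1),
    (j.factorial : ℝ) / ((j-k).factorial * ((k.factorial : ℝ))^2) * (-t)^k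

/-- Laguerre function of order `0`. -/
def lagFun0 (j : ℕ) (t : ℝ) : ℝ := lag0 j t * Real.exp (-t/2)

def LagFun0 {d : ℕ} (n : Fin d → ℕ) (t : Fin d → ℝ) : ℝ := ∏ l, lagFun0 (n l) (t l)

/-- The Wigner-type transform
`W̃(f,g)(x,ξ) = (2π)^{−d/2} ∫ e^{−iξ·p} f(x+p/2) g(x−p/2) dp`. -/
def Wig {d : ℕ} (f g : (Fin d → ℝ) → ℂ) (x ξ : Fin d → ℝ) : ℂ :=
  (((2 * Real.pi) ^ (-(d:ℝ)/2) : ℝ) : ℂ) *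
    ∫ p : Fin d → ℝ, Complex.exp (-Complex.I * ((∑ l, ξ l * p l : ℝ) : ℂ)) *
      f (fun l => x l + p l / 2) * g (fun l => x l - p l / 2)

/-! ### Hermite polynomials -/

/-- The physicists' Hermite polynomials, by recursion. -/
def hermitePoly : ℕ → Polynomial ℝ
  | 0 => 1
  | j + 1 => 2 * Polynomial.X * hermitePoly j - (hermitePoly j).derivative

lemma hasDerivAt_eval_mul_exp_neg_sq (P : Polynomial ℝ) (t : ℝ) :
    HasDerivAt (fun s => P.eval s * Real.exp (-(s ^ 2)))
      (-((2 * Polynomial.X * P - P.derivative).eval t * Real.exp (-(t ^ 2)))) t := by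
  have h1 := P.hasDerivAt t
  have h2 : HasDerivAt (fun s : ℝ => Real.exp (-(s ^ 2))) (Real.exp (-(t ^ 2)) * (-(2 * t))) t := by
    have := ((hasDerivAt_id t).pow 2).neg.exp
    simpa using this
  refine (h1.mul h2).congr_deriv ?_
  simp
  ring

lemma iterate_deriv_exp_neg_sq (j : ℕ) :
    (deriv^[j] fun s : ℝ => Real.exp (-(s ^ 2))) =
      fun s => (-1) ^ j * ((hermitePoly j).eval s * Real.exp (-(s ^ 2))) := by
  induction j with
  | zero => simp [hermitePoly]
  | succ j ih =>
    rw [Function.iterate_succ_apply', ih]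
    funext t
    rw [((hasDerivAt_eval_mul_exp_neg_sq (hermitePoly j) t).const_mul _).deriv]
    simp only [hermitePoly]
    ring

lemma hermP_eq_eval (j : ℕ) (t : ℝ) : hermP j t = (hermitePoly j).eval t := by
  rw [hermP, iterate_deriv_exp_neg_sq]
  have h : Real.exp (t ^ 2) * Real.exp (-(t ^ 2)) = 1 := by
    rw [← Real.exp_add]; simp
  have h' : ((-1 : ℝ) ^ j) * (-1) ^ j = 1 := by
    rw [← mul_pow]; simp
  calc _ = (((-1 : ℝ) ^ j) * (-1) ^ j) * (Real.exp (t ^ 2) * Real.exp (-(t ^ 2))) *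
        (hermitePoly j).eval t := by ring
    _ = _ := by rw [h, h']; ring

lemma derivative_hermitePoly_succ (j : ℕ) :
    (hermitePoly (j + 1)).derivative = (2 * (j + 1 : ℝ)) • hermitePoly j := by
  induction j with
  | zero =>
    simp [hermitePoly, Polynomial.smul_eq_C_mul]
    exact (map_ofNat Polynomial.C 2).symm
  | succ j ih =>
    rw [hermitePoly, Polynomial.derivative_sub, Polynomial.derivative_mul, ih,
      Polynomial.derivative_smul]
    conv_rhs => rw [hermitePoly]
    have h2 : Polynomial.derivative (2 * Polynomial.X : Polynomial ℝ) = 2 := by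
      simp
    rw [h2]
    conv_lhs => rw [hermitePoly]
    simp only [Polynomial.smul_eq_C_mul]
    push_cast
    simp only [map_mul, map_add, map_one, map_natCast, map_ofNat]
    ring

lemma integrable_eval_mul_exp_neg_sq (P : Polynomial ℝ) :
    Integrable (fun x : ℝ => P.eval x * Real.exp (-(x ^ 2))) := by
  induction P using Polynomial.induction_on' with
  | add p q hp hq =>
    simp only [Polynomial.eval_add, add_mul]
    exact hp.add hq
  | monomial n a =>
    have := (integrable_rpow_mul_exp_neg_mul_sq (b := 1) one_pos (s := n)
      (by have : (0 : ℝ) ≤ n := Nat.cast_nonneg n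
          linarith)).const_mul a
    simpa [mul_assoc] using this

/-- The normalisation constant of the Hermite functions. -/
def hermNorm (j : ℕ) : ℝ := ((2 : ℝ) ^ j * (j.factorial : ℝ) * Real.sqrt Real.pi) ^ (-(1 / 2 : ℝ))

lemma hermNorm_sq (j : ℕ) :
    hermNorm j * hermNorm j = ((2 : ℝ) ^ j * (j.factorial : ℝ) * Real.sqrt Real.pi)⁻¹ := by
  have h : 0 < (2 : ℝ) ^ j * (j.factorial : ℝ) * Real.sqrt Real.pi := by positivity
  rw [hermNorm, ← Real.rpow_add h, ← Real.rpow_neg_one]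
  norm_num

lemma hermFun_eq (j : ℕ) (t : ℝ) :
    hermFun j t = hermNorm j * Real.exp (-(t ^ 2) / 2) * (hermitePoly j).eval t := by
  rw [hermFun, hermP_eq_eval, hermNorm]

lemma hermFun_mul_hermFun (j k : ℕ) (t : ℝ) :
    hermFun j t * hermFun k t = hermNorm j * hermNorm k *
      ((hermitePoly j * hermitePoly k).eval t * Real.exp (-(t ^ 2))) := by
  have : Real.exp (-(t ^ 2)) = Real.exp (-(t ^ 2) / 2) * Real.exp (-(t ^ 2) / 2) := by
    rw [← Real.exp_add]; ring_nf
  rw [hermFun_eq, hermFun_eq, this, Polynomial.eval_mul]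
  ring

lemma continuous_hermFun (j : ℕ) : Continuous (hermFun j) := by
  have : hermFun j = fun t => hermNorm j * Real.exp (-(t ^ 2) / 2) * (hermitePoly j).eval t :=
    funext (hermFun_eq j)
  rw [this]
  fun_prop

lemma integral_mul_hermitePoly_succ (P : Polynomial ℝ) (j : ℕ) :
    ∫ x : ℝ, (P * hermitePoly (j + 1)).eval x * Real.exp (-(x ^ 2)) =
      ∫ x : ℝ, (P.derivative * hermitePoly j).eval x * Real.exp (-(x ^ 2)) := by
  have h := integral_mul_deriv_eq_deriv_mul_of_integrable (u := fun x => P.eval x)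
    (v := fun x => (hermitePoly j).eval x * Real.exp (-(x ^ 2)))
    (u' := fun x => P.derivative.eval x)
    (v' := fun x => -((hermitePoly (j + 1)).eval x * Real.exp (-(x ^ 2))))
    (fun x _ => P.hasDerivAt x) (fun x _ => hasDerivAt_eval_mul_exp_neg_sq _ x)
    (by
      have := (integrable_eval_mul_exp_neg_sq (P * hermitePoly (j + 1))).neg
      refine this.congr (ae_of_all _ fun x => ?_)
      simp only [Pi.neg_apply, Pi.mul_apply, Polynomial.eval_mul]; ring)
    (by
      have := (integrable_eval_mul_exp_neg_sq (P.derivative * hermitePoly j))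
      refine this.congr (ae_of_all _ fun x => ?_)
      simp only [Pi.mul_apply, Polynomial.eval_mul]; ring)
    (by
      have := (integrable_eval_mul_exp_neg_sq (P * hermitePoly j))
      refine this.congr (ae_of_all _ fun x => ?_)
      simp only [Pi.mul_apply, Polynomial.eval_mul]; ring)
  simp only [mul_neg, integral_neg, neg_inj] at h
  simpa only [Polynomial.eval_mul, mul_assoc] using h

lemma integral_hermitePoly_mul (j k : ℕ) :
    ∫ x : ℝ, (hermitePoly j * hermitePoly k).eval x * Real.exp (-(x ^ 2)) =
      if j = k then (2 : ℝ) ^ j * (j.factorial : ℝ) * Real.sqrt Real.pi else 0 := by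
  induction k generalizing j with
  | zero =>
    cases j with
    | zero =>
      have := integral_gaussian 1
      simpa [hermitePoly] using this
    | succ j =>
      rw [mul_comm, integral_mul_hermitePoly_succ]
      simp [hermitePoly]
  | succ k ih =>
    rw [integral_mul_hermitePoly_succ]
    cases j with
    | zero => simp [hermitePoly]
    | succ j =>
      rw [derivative_hermitePoly_succ]
      simp only [smul_mul_assoc, Polynomial.eval_smul, smul_eq_mul, mul_assoc]
      rw [integral_const_mul, integral_const_mul, ih]
      by_cases h : j = k
      · subst h
        simp [Nat.factorial_succ]; ring
      · simp [h]

lemma integral_hermFun_mul (j k : ℕ) :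
    ∫ x : ℝ, hermFun j x * hermFun k x = if j = k then 1 else 0 := by
  simp only [hermFun_mul_hermFun]
  rw [integral_const_mul, integral_hermitePoly_mul]
  by_cases h : j = k
  · subst h
    have h : (2 : ℝ) ^ j * (j.factorial : ℝ) * Real.sqrt Real.pi ≠ 0 := by positivity
    simp only [if_true]
    rw [hermNorm_sq, inv_mul_cancel₀ h]
  · simp [h]

lemma integrable_hermFun_mul (j k : ℕ) : Integrable (fun x => hermFun j x * hermFun k x) := by
  simp only [hermFun_mul_hermFun]
  exact (integrable_eval_mul_exp_neg_sq _).const_mul _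

/-- Gaussian-modulated plane waves on the line. -/
def gaussWave (a : ℝ) (x : ℝ) : ℂ := Complex.exp (-(x ^ 2 : ℂ) / 2 + Complex.I * a * x)

lemma integral_hermitePoly_mul_planeWave (a : ℝ) (k : ℕ) :
    ∫ x : ℝ, (((hermitePoly k).eval x * Real.exp (-(x ^ 2)) : ℝ) : ℂ) *
        Complex.exp (Complex.I * a * x) =
      (Complex.I * a) ^ k * (Real.sqrt Real.pi * Complex.exp (-(a ^ 2 : ℂ) / 4)) := by
  have hint : ∀ P : Polynomial ℝ, Integrable (fun x : ℝ =>
      ((P.eval x * Real.exp (-(x ^ 2)) : ℝ) : ℂ) * Complex.exp (Complex.I * a * x)) := by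
    intro P
    have h1 := (integrable_eval_mul_exp_neg_sq P).ofReal (𝕜 := ℂ)
    refine h1.mul_bdd (c := 1) (by fun_prop) (ae_of_all _ fun x => ?_)
    rw [show Complex.I * a * x = ((a * x : ℝ) : ℂ) * Complex.I by push_cast; ring,
      Complex.norm_exp_ofReal_mul_I]
  induction k with
  | zero =>
    have := integral_cexp_quadratic (b := -1) (by simp) (Complex.I * a) 0
    simp only [hermitePoly, Polynomial.eval_one, one_mul, pow_zero]
    have e : ∀ x : ℝ, ((Real.exp (-(x ^ 2)) : ℝ) : ℂ) * Complex.exp (Complex.I * a * x) =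
        Complex.exp (-1 * (x : ℂ) ^ 2 + Complex.I * a * x + 0) := by
      intro x
      push_cast
      rw [← Complex.exp_add]; ring_nf
    simp only [e]
    rw [this]
    congr 1
    · rw [Real.sqrt_eq_rpow, Complex.ofReal_cpow Real.pi_pos.le]
      norm_num
    · congr 1
      rw [mul_pow, Complex.I_sq]; ring
  | succ k ih =>
    have h := integral_mul_deriv_eq_deriv_mul_of_integrable
      (u := fun x : ℝ => Complex.exp (Complex.I * a * x))
      (v := fun x : ℝ => (((hermitePoly k).eval x * Real.exp (-(x ^ 2)) : ℝ) : ℂ))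
      (u' := fun x : ℝ => Complex.exp (Complex.I * a * x) * (Complex.I * a))
      (v' := fun x : ℝ => ((-((hermitePoly (k + 1)).eval x * Real.exp (-(x ^ 2))) : ℝ) : ℂ))
      (fun x _ => by
        have := ((hasDerivAt_id (x : ℂ)).const_mul (Complex.I * a)).cexp.comp_ofReal
        simpa using this)
      (fun x _ => (hasDerivAt_eval_mul_exp_neg_sq _ x).ofReal_comp)
      (by
        refine (hint (hermitePoly (k + 1))).neg.congr (ae_of_all _ fun x => ?_)
        simp only [Pi.neg_apply, Pi.mul_apply]; push_cast; ring)
      (by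
        refine ((hint (hermitePoly k)).const_mul (Complex.I * a)).congr (ae_of_all _ fun x => ?_)
        simp only [Pi.mul_apply]; ring)
      (by
        refine (hint (hermitePoly k)).congr (ae_of_all _ fun x => ?_)
        simp only [Pi.mul_apply]; ring)
    simp only [Complex.ofReal_neg, mul_neg, integral_neg, neg_inj] at h
    rw [pow_succ', mul_assoc, ← ih, ← integral_const_mul]
    calc _ = _ := by simp only [mul_comm]
      _ = _ := h
      _ = _ := by congr 1; funext x; ring

lemma integral_gaussWave_mul_hermFun (a : ℝ) (k : ℕ) :
    ∫ x : ℝ, gaussWave a x * (hermFun k x : ℂ) =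
      hermNorm k * ((Complex.I * a) ^ k * (Real.sqrt Real.pi * Complex.exp (-(a ^ 2 : ℂ) / 4))) := by
  rw [← integral_hermitePoly_mul_planeWave, ← integral_const_mul]
  congr 1; funext x
  rw [gaussWave, hermFun_eq, Complex.exp_add]
  have : ((Real.exp (-(x ^ 2)) : ℝ) : ℂ) =
      Complex.exp (-(x ^ 2 : ℂ) / 2) * Complex.exp (-(x ^ 2 : ℂ) / 2) := by
    rw [← Complex.exp_add]; push_cast; ring_nf
  simp only [Complex.ofReal_mul, this]
  push_cast
  ring

lemma integral_gaussWave_mul_gaussWave_hermFun (a b : ℝ) (k : ℕ) :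
    (∫ x : ℝ, gaussWave a x * (hermFun k x : ℂ)) * (∫ x : ℝ, gaussWave b x * (hermFun k x : ℂ)) =
      Real.sqrt Real.pi * Complex.exp (-(a ^ 2 + b ^ 2 : ℂ) / 4) *
        ((-(a * b / 2 : ℂ)) ^ k / k.factorial) := by
  rw [integral_gaussWave_mul_hermFun, integral_gaussWave_mul_hermFun]
  have h1 : ((hermNorm k : ℂ)) * hermNorm k =
      ((2 : ℂ) ^ k * (k.factorial : ℂ) * (Real.sqrt Real.pi : ℂ))⁻¹ := by
    exact_mod_cast congrArg (fun r : ℝ => (r : ℂ)) (hermNorm_sq k)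
  have h2 : Complex.exp (-(a ^ 2 : ℂ) / 4) * Complex.exp (-(b ^ 2 : ℂ) / 4) =
      Complex.exp (-(a ^ 2 + b ^ 2 : ℂ) / 4) := by
    rw [← Complex.exp_add]; ring_nf
  have h3 : (-(a * b / 2 : ℂ)) ^ k = (Complex.I * a) ^ k * (Complex.I * b) ^ k / 2 ^ k := by
    rw [← mul_pow, ← div_pow]; congr 1
    rw [show Complex.I * a * (Complex.I * b) = Complex.I ^ 2 * (a * b) by ring, Complex.I_sq]; ring
  have h4 : (Real.sqrt Real.pi : ℂ) ≠ 0 := by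
    exact_mod_cast (Real.sqrt_pos.2 Real.pi_pos).ne'
  have h5 : (k.factorial : ℂ) ≠ 0 := by exact_mod_cast k.factorial_ne_zero
  rw [h3, ← h2]
  calc _ = (hermNorm k * hermNorm k : ℂ) * ((Complex.I * a) ^ k * (Complex.I * b) ^ k *
        (Real.sqrt Real.pi : ℂ) * (Real.sqrt Real.pi : ℂ) *
        (Complex.exp (-(a ^ 2 : ℂ) / 4) * Complex.exp (-(b ^ 2 : ℂ) / 4))) := by ring
    _ = _ := by
      rw [h1]
      field_simp

/-! ### Laguerre functions of order zero -/

/-- The Laguerre polynomials of order `0` as elements of `ℝ[X]`. -/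
def lagPoly (k : ℕ) : Polynomial ℝ :=
  ∑ m ∈ Finset.range (k + 1), Polynomial.C ((k.choose m : ℝ) * (-1) ^ m / m.factorial) *
    Polynomial.X ^ m

lemma coeff_lagPoly (k m : ℕ) :
    (lagPoly k).coeff m = (k.choose m : ℝ) * (-1) ^ m / m.factorial := by
  simp only [lagPoly, Polynomial.finsetSum_coeff, Polynomial.coeff_C_mul_X_pow]
  rw [Finset.sum_ite_eq]
  split_ifs with h
  · rfl
  · rw [Finset.mem_range, not_lt] at h
    rw [Nat.choose_eq_zero_of_lt (by omega)]
    simp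

lemma lag0_eq_sum (k : ℕ) (t : ℝ) :
    lag0 k t = ∑ m ∈ Finset.range (k + 1), (k.choose m : ℝ) * ((-t) ^ m / m.factorial) := by
  refine Finset.sum_congr rfl fun m hm => ?_
  have hm : m ≤ k := by simpa [Nat.lt_succ_iff] using hm
  rw [Nat.cast_choose ℝ hm]
  have h1 : (m.factorial : ℝ) ≠ 0 := by positivity
  have h2 : ((k - m).factorial : ℝ) ≠ 0 := by positivity
  field_simp

lemma lag0_eq_eval (k : ℕ) (t : ℝ) : lag0 k t = (lagPoly k).eval t := by
  rw [lag0_eq_sum, lagPoly, Polynomial.eval_finsetSum]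
  refine Finset.sum_congr rfl fun m _ => ?_
  simp only [Polynomial.eval_mul, Polynomial.eval_C, Polynomial.eval_pow, Polynomial.eval_X]
  rw [neg_pow]; ring

lemma derivative_lagPoly_succ (k : ℕ) :
    (lagPoly (k + 1)).derivative = (lagPoly k).derivative - lagPoly k := by
  ext m
  simp only [Polynomial.coeff_derivative, Polynomial.coeff_sub, coeff_lagPoly]
  have h : ((m + 1).factorial : ℝ) = (m + 1) * m.factorial := by
    rw [Nat.factorial_succ]; push_cast; ring
  have h1 : (m.factorial : ℝ) ≠ 0 := by positivity
  have h2 : (m + 1 : ℝ) ≠ 0 := by positivity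
  rw [Nat.choose_succ_succ, h]
  push_cast
  field_simp
  ring

lemma eval_zero_lagPoly (k : ℕ) : (lagPoly k).eval 0 = 1 := by
  rw [← Polynomial.coeff_zero_eq_eval_zero, coeff_lagPoly]; simp

lemma integrableOn_eval_mul_exp_neg (P : Polynomial ℝ) :
    IntegrableOn (fun x : ℝ => P.eval x * Real.exp (-x)) (Set.Ioi 0) := by
  induction P using Polynomial.induction_on' with
  | add p q hp hq =>
    simp only [Polynomial.eval_add, add_mul]
    exact hp.add hq
  | monomial n a =>
    have := (Real.GammaIntegral_convergent (s := n + 1) (by positivity)).const_mul a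
    simp only [add_sub_cancel_right, Real.rpow_natCast] at this
    refine this.congr (ae_of_all _ fun x => ?_)
    simp only [Polynomial.eval_monomial]; ring

lemma integral_derivative_mul_exp_neg (P : Polynomial ℝ) :
    ∫ x in Set.Ioi (0 : ℝ), P.derivative.eval x * Real.exp (-x) =
      (∫ x in Set.Ioi (0 : ℝ), P.eval x * Real.exp (-x)) - P.eval 0 := by
  have hd : ∀ x ∈ Set.Ici (0 : ℝ), HasDerivAt (fun x => P.eval x * Real.exp (-x))
      (P.derivative.eval x * Real.exp (-x) - P.eval x * Real.exp (-x)) x := by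
    intro x _
    have h2 : HasDerivAt (fun x : ℝ => Real.exp (-x)) (Real.exp (-x) * -1) x :=
      (hasDerivAt_neg x).exp
    refine ((P.hasDerivAt x).mul h2).congr_deriv (by ring)
  have h := integral_Ioi_of_hasDerivAt_of_tendsto' hd
    ((integrableOn_eval_mul_exp_neg P.derivative).sub (integrableOn_eval_mul_exp_neg P))
    (m := 0) (by
      refine (Polynomial.tendsto_div_exp_atTop P).congr fun x => ?_
      rw [Real.exp_neg]; rfl)
  rw [integral_sub (integrableOn_eval_mul_exp_neg P.derivative)
    (integrableOn_eval_mul_exp_neg P)] at h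
  simp only [neg_zero, Real.exp_zero, mul_one] at h
  linarith

/-- The inner product of two Laguerre polynomials. -/
def lagInner (j k : ℕ) : ℝ :=
  ∫ x in Set.Ioi (0 : ℝ), (lagPoly j * lagPoly k).eval x * Real.exp (-x)

lemma lagInner_comm (j k : ℕ) : lagInner j k = lagInner k j := by
  rw [lagInner, lagInner, mul_comm]

lemma integral_derivative_lagPoly_mul (j k : ℕ) :
    ∫ x in Set.Ioi (0 : ℝ), ((lagPoly j).derivative * lagPoly k).eval x * Real.exp (-x) =
      -∑ i ∈ Finset.range j, lagInner i k := by
  induction j with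
  | zero => simp [lagPoly]
  | succ j ih =>
    rw [Finset.sum_range_succ, neg_add, ← ih, derivative_lagPoly_succ, lagInner, ← sub_eq_add_neg,
      ← integral_sub (integrableOn_eval_mul_exp_neg _) (integrableOn_eval_mul_exp_neg _)]
    congr 1; funext x
    simp only [Polynomial.eval_mul, Polynomial.eval_sub]; ring

lemma lagInner_eq_one_sub (j k : ℕ) :
    lagInner j k = 1 - ∑ i ∈ Finset.range j, lagInner i k -
      ∑ i ∈ Finset.range k, lagInner i j := by
  have h := integral_derivative_mul_exp_neg (lagPoly j * lagPoly k)
  rw [Polynomial.eval_mul, eval_zero_lagPoly, eval_zero_lagPoly, Polynomial.derivative_mul] at h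
  have h2 := integral_derivative_lagPoly_mul j k
  have h3 := integral_derivative_lagPoly_mul k j
  rw [mul_comm] at h3
  simp only [Polynomial.eval_add, add_mul] at h
  rw [integral_add (integrableOn_eval_mul_exp_neg _) (integrableOn_eval_mul_exp_neg _), h2, h3] at h
  rw [lagInner]
  linarith

lemma lagInner_of_le (k : ℕ) : ∀ j ≤ k, lagInner j k = if j = k then 1 else 0 := by
  induction k using Nat.strong_induction_on with
  | _ k ihk =>
    intro j
    induction j using Nat.strong_induction_on with
    | _ j ihj =>
      intro hjk
      rw [lagInner_eq_one_sub]
      have h1 : ∑ i ∈ Finset.range j, lagInner i k = 0 := by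
        refine Finset.sum_eq_zero fun i hi => ?_
        rw [Finset.mem_range] at hi
        rw [ihj i hi (by omega), if_neg (by omega)]
      rw [h1]
      by_cases h : j = k
      · subst h
        rw [h1]; simp
      · have h2 : ∀ i ∈ Finset.range k, lagInner i j = if i = j then 1 else 0 := by
          intro i hi
          rw [Finset.mem_range] at hi
          by_cases hij : i ≤ j
          · exact ihk j (by omega) i hij
          · rw [lagInner_comm, ihk i hi j (by omega)]
            simp [eq_comm]
        rw [Finset.sum_congr rfl h2, Finset.sum_ite_eq', if_pos (Finset.mem_range.2 (by omega)),
          if_neg h]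
        norm_num

lemma lagFun0_sq (k : ℕ) (t : ℝ) :
    lagFun0 k t ^ 2 = (lagPoly k * lagPoly k).eval t * Real.exp (-t) := by
  have : Real.exp (-t) = Real.exp (-t / 2) * Real.exp (-t / 2) := by
    rw [← Real.exp_add]; ring_nf
  rw [lagFun0, lag0_eq_eval, this, Polynomial.eval_mul]
  ring

lemma integral_lagFun0_sq (k : ℕ) : ∫ x in Set.Ioi (0 : ℝ), lagFun0 k x ^ 2 = 1 := by
  simp only [lagFun0_sq]
  have := lagInner_of_le k k le_rfl
  rwa [if_pos rfl] at this

lemma integrableOn_lagFun0_sq (k : ℕ) :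
    IntegrableOn (fun x => lagFun0 k x ^ 2) (Set.Ioi (0 : ℝ)) := by
  simp only [lagFun0_sq]
  exact integrableOn_eval_mul_exp_neg _

lemma continuous_lagFun0 (k : ℕ) : Continuous (lagFun0 k) := by
  have : lagFun0 k = fun t => (lagPoly k).eval t * Real.exp (-t / 2) := by
    funext t; rw [lagFun0, lag0_eq_eval]
  rw [this]
  fun_prop

lemma abs_lagFun0_le (k : ℕ) {t : ℝ} (ht : 0 ≤ t) : |lagFun0 k t| ≤ 3 ^ k := by
  rw [lagFun0, abs_mul, abs_of_pos (Real.exp_pos _), lag0_eq_sum]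
  have h1 : ∀ m : ℕ, |(-t) ^ m / m.factorial| ≤ 2 ^ m * Real.exp (t / 2) := by
    intro m
    have := Real.pow_div_factorial_le_exp (x := t / 2) (by positivity) m
    rw [abs_div, abs_pow, abs_neg, abs_of_nonneg ht, Nat.abs_cast]
    calc t ^ m / m.factorial = 2 ^ m * ((t / 2) ^ m / m.factorial) := by
          rw [div_pow]; field_simp
      _ ≤ _ := by gcongr
  have h2 : |∑ m ∈ Finset.range (k + 1), (k.choose m : ℝ) * ((-t) ^ m / m.factorial)| ≤
      ∑ m ∈ Finset.range (k + 1), (k.choose m : ℝ) * (2 ^ m * Real.exp (t / 2)) := by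
    refine (Finset.abs_sum_le_sum_abs _ _).trans (Finset.sum_le_sum fun m _ => ?_)
    rw [abs_mul, Nat.abs_cast]
    exact mul_le_mul_of_nonneg_left (h1 m) (Nat.cast_nonneg _)
  have h3 : ∑ m ∈ Finset.range (k + 1), (k.choose m : ℝ) * (2 ^ m * Real.exp (t / 2)) =
      3 ^ k * Real.exp (t / 2) := by
    rw [show (3 : ℝ) = 2 + 1 by norm_num, add_pow, Finset.sum_mul]
    refine Finset.sum_congr rfl fun m _ => ?_
    rw [one_pow]; ring
  calc _ ≤ (3 ^ k * Real.exp (t / 2)) * Real.exp (-t / 2) := by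
        rw [← h3]; gcongr
    _ = 3 ^ k := by
        rw [mul_assoc, ← Real.exp_add]; ring_nf; simp

/-- The series `∑ zⁿ / (n!)²`. -/
def besselSeries (z : ℂ) : ℂ := ∑' n : ℕ, z ^ n / (n.factorial : ℂ) ^ 2

lemma summable_norm_besselSeries (z : ℂ) :
    Summable fun n : ℕ => ‖z ^ n / (n.factorial : ℂ) ^ 2‖ := by
  refine (NormedSpace.norm_expSeries_div_summable z).of_nonneg_of_le (fun _ => norm_nonneg _)
    fun n => ?_
  have h : (1 : ℝ) ≤ n.factorial := by exact_mod_cast n.factorial_pos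
  simp only [norm_div, norm_pow, Complex.norm_natCast]
  gcongr
  nlinarith

lemma complex_exp_eq_tsum (z : ℂ) : Complex.exp z = ∑' n : ℕ, z ^ n / n.factorial := by
  rw [Complex.exp_eq_exp_ℂ]
  exact (NormedSpace.expSeries_div_hasSum_exp z).tsum_eq.symm

lemma summable_lagFun0_genFun (z : ℂ) {t : ℝ} (ht : 0 ≤ t) :
    Summable fun k : ℕ => ‖z ^ k / (k.factorial : ℂ) * (lagFun0 k t : ℂ)‖ := by
  refine (NormedSpace.norm_expSeries_div_summable (3 * z)).of_nonneg_of_le (fun _ => norm_nonneg _)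
    fun n => ?_
  simp only [norm_mul, norm_div, norm_pow, Complex.norm_natCast, Complex.norm_real, Real.norm_eq_abs,
    Complex.norm_ofNat]
  rw [mul_pow, mul_div_assoc, mul_comm]
  gcongr
  exact abs_lagFun0_le n ht

lemma tsum_lagFun0_genFun (z : ℂ) (t : ℝ) :
    ∑' k : ℕ, z ^ k / (k.factorial : ℂ) * (lagFun0 k t : ℂ) =
      Complex.exp (-(t : ℂ) / 2) * (Complex.exp z * besselSeries (-(z * t))) := by
  rw [mul_comm (Complex.exp z), complex_exp_eq_tsum z, besselSeries,
    tsum_mul_tsum_eq_tsum_sum_range_of_summable_norm (summable_norm_besselSeries _)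
      (NormedSpace.norm_expSeries_div_summable z), ← tsum_mul_left]
  congr 1; funext k
  rw [lagFun0, lag0_eq_sum]
  push_cast
  rw [mul_comm (Complex.exp _), ← mul_assoc]
  congr 1
  rw [Finset.mul_sum]
  refine Finset.sum_congr rfl fun m hm => ?_
  have hm : m ≤ k := by simpa [Nat.lt_succ_iff] using hm
  rw [Nat.cast_choose ℂ hm]
  have h1 : (m.factorial : ℂ) ≠ 0 := by exact_mod_cast m.factorial_ne_zero
  have h2 : ((k - m).factorial : ℂ) ≠ 0 := by exact_mod_cast (k - m).factorial_ne_zero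
  have h3 : (k.factorial : ℂ) ≠ 0 := by exact_mod_cast k.factorial_ne_zero
  have h4 : z ^ k = z ^ m * z ^ (k - m) := by rw [← pow_add]; congr 1; omega
  rw [h4, ← mul_neg, mul_pow]
  field_simp

/-! ### The angular integral -/

lemma integral_Ioo_exp_int (m n : ℕ) :
    ∫ θ in Set.Ioo (-Real.pi) Real.pi, Complex.exp (((n : ℂ) - m) * Complex.I * θ) =
      if m = n then (2 * Real.pi : ℂ) else 0 := by
  rw [← integral_Ioc_eq_integral_Ioo, ← intervalIntegral.integral_of_le (by linarith [Real.pi_pos])]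
  split_ifs with h
  · subst h
    simp; ring
  · have h1 : (n : ℂ) - m ≠ 0 := by
      rw [sub_ne_zero]; exact_mod_cast Ne.symm h
    rw [integral_exp_mul_complex (mul_ne_zero h1 Complex.I_ne_zero)]
    rw [div_eq_zero_iff]; left
    rw [sub_eq_zero, Complex.exp_eq_exp_iff_exists_int]
    refine ⟨(n : ℤ) - m, ?_⟩
    push_cast; ring

lemma integral_Ioo_exp_add (A B : ℂ) :
    ∫ θ in Set.Ioo (-Real.pi) Real.pi,
      Complex.exp (A * Complex.exp (-(Complex.I * θ)) + B * Complex.exp (Complex.I * θ)) =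
      2 * Real.pi * besselSeries (A * B) := by
  set F : ℕ × ℕ → ℝ → ℂ := fun p θ => (A ^ p.1 / p.1.factorial * (B ^ p.2 / p.2.factorial)) *
    Complex.exp (((p.2 : ℂ) - p.1) * Complex.I * θ) with hF
  have hnorm : ∀ p θ, ‖F p θ‖ = ‖A ^ p.1 / p.1.factorial * (B ^ p.2 / p.2.factorial)‖ := by
    intro p θ
    rw [hF]
    simp only
    rw [norm_mul, show ((p.2 : ℂ) - p.1) * Complex.I * θ =
      ((((p.2 : ℝ) - p.1) * θ : ℝ) : ℂ) * Complex.I by push_cast; ring,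
      Complex.norm_exp_ofReal_mul_I, mul_one]
  have hsum : Summable fun p : ℕ × ℕ => ‖A ^ p.1 / (p.1.factorial : ℂ) *
      (B ^ p.2 / (p.2.factorial : ℂ))‖ :=
    Summable.mul_norm (f := fun n : ℕ => A ^ n / (n.factorial : ℂ))
      (g := fun n : ℕ => B ^ n / (n.factorial : ℂ))
      (NormedSpace.norm_expSeries_div_summable A) (NormedSpace.norm_expSeries_div_summable B)
  have hexp : ∀ θ : ℝ, Complex.exp (A * Complex.exp (-(Complex.I * θ)) +
      B * Complex.exp (Complex.I * θ)) = ∑' p, F p θ := by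
    intro θ
    rw [Complex.exp_add, complex_exp_eq_tsum (A * _), complex_exp_eq_tsum (B * _)]
    refine (tsum_mul_tsum_of_summable_norm
      (f := fun n : ℕ => (A * Complex.exp (-(Complex.I * θ))) ^ n / (n.factorial : ℂ))
      (g := fun n : ℕ => (B * Complex.exp (Complex.I * θ)) ^ n / (n.factorial : ℂ))
      (NormedSpace.norm_expSeries_div_summable _)
      (NormedSpace.norm_expSeries_div_summable _)).trans ?_
    congr 1; funext p
    rw [hF]
    simp only
    rw [mul_pow, mul_pow, ← Complex.exp_nat_mul, ← Complex.exp_nat_mul,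
      show ((p.2 : ℂ) - p.1) * Complex.I * θ =
        p.1 * -(Complex.I * θ) + p.2 * (Complex.I * θ) by ring, Complex.exp_add]
    ring
  have hint : ∀ p, Integrable (F p) (volume.restrict (Set.Ioo (-Real.pi) Real.pi)) := by
    intro p
    refine (ContinuousOn.integrableOn_Icc (a := -Real.pi) (b := Real.pi) ?_).mono_set
      Set.Ioo_subset_Icc_self
    exact Continuous.continuousOn (by rw [hF]; fun_prop)
  simp only [hexp]
  rw [← integral_tsum_of_summable_integral_norm hint (by
    simp only [hnorm, integral_const, smul_eq_mul]
    exact hsum.mul_left _)]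
  have hval : ∀ p : ℕ × ℕ, ∫ θ in Set.Ioo (-Real.pi) Real.pi, F p θ =
      (A ^ p.1 / p.1.factorial * (B ^ p.2 / p.2.factorial)) *
        if p.1 = p.2 then (2 * Real.pi : ℂ) else 0 := by
    intro p
    rw [hF]
    simp only
    rw [integral_const_mul, integral_Ioo_exp_int]
  simp only [hval]
  rw [Summable.tsum_prod, besselSeries, ← tsum_mul_left]
  · congr 1; funext n
    simp only [mul_ite, mul_zero]
    rw [tsum_ite_eq']
    rw [mul_pow]
    ring
  · refine Summable.of_norm_bounded (g := fun p => ‖A ^ p.1 / (p.1.factorial : ℂ) *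
      (B ^ p.2 / (p.2.factorial : ℂ))‖ * (2 * Real.pi)) (hsum.mul_right _) fun p => ?_
    rw [norm_mul]
    gcongr
    split_ifs
    · simp [abs_of_pos Real.pi_pos]
    · simp [Real.pi_pos.le]

/-! ### Products of series -/

lemma summable_norm_prod_and_tsum_prod {d : ℕ} (f : Fin d → ℕ → ℂ)
    (hf : ∀ l, Summable fun n => ‖f l n‖) :
    (Summable fun k : Fin d → ℕ => ‖∏ l, f l (k l)‖) ∧
      ∑' k : Fin d → ℕ, ∏ l, f l (k l) = ∏ l, ∑' n, f l n := by
  induction d with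
  | zero =>
    constructor
    · exact Summable.of_finite
    · simp
  | succ d ih =>
    obtain ⟨h1, h2⟩ := ih (fun l => f l.succ) (fun l => hf l.succ)
    set F : (Fin d → ℕ) → ℂ := fun k => ∏ l, f l.succ (k l) with hF
    have hsum : Summable fun p : ℕ × (Fin d → ℕ) => ‖f 0 p.1 * F p.2‖ :=
      Summable.mul_norm (f := f 0) (g := F) (hf 0) h1
    have hcons : ∀ p : ℕ × (Fin d → ℕ),
        ∏ l, f l ((Fin.consEquiv (fun _ : Fin (d + 1) => ℕ)) p l) = f 0 p.1 * F p.2 := by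
      intro p
      rw [Fin.prod_univ_succ]
      simp [Fin.consEquiv, hF]
    constructor
    · rw [← (Fin.consEquiv (fun _ : Fin (d + 1) => ℕ)).summable_iff]
      refine hsum.congr fun p => ?_
      simp only [Function.comp, hcons]
    · rw [← (Fin.consEquiv (fun _ : Fin (d + 1) => ℕ)).tsum_eq]
      simp only [hcons]
      rw [Fin.prod_univ_succ, ← h2]
      exact (tsum_mul_tsum_of_summable_norm (f := f 0) (g := F) (hf 0) h1).symm

/-! ### Radial coordinates adapted to the symbol -/

/-- The angular measure, a quarter of Lebesgue measure on `(-π, π)`. -/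
def angleMeasure : Measure ℝ := (4 : ENNReal)⁻¹ • (volume.restrict (Set.Ioo (-Real.pi) Real.pi))

instance : IsFiniteMeasure angleMeasure := by
  unfold angleMeasure
  exact Measure.smul_finite _ (by simp)

def radialMap (p : ℝ × ℝ) : ℝ × ℝ :=
  (Real.sqrt (p.1 / 2) * Real.cos p.2, Real.sqrt (p.1 / 2) * Real.sin p.2)

lemma continuous_radialMap : Continuous radialMap := by
  unfold radialMap
  fun_prop

lemma lintegral_Ioi_two_mul_sq (u : ℝ → ENNReal) :
    ∫⁻ ρ in Set.Ioi (0 : ℝ), u ρ =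
      ∫⁻ r in Set.Ioi (0 : ℝ), ENNReal.ofReal (4 * r) * u (2 * r ^ 2) := by
  have himg : (fun r : ℝ => 2 * r ^ 2) '' Set.Ioi 0 = Set.Ioi 0 := by
    ext y
    simp only [Set.mem_image, Set.mem_Ioi]
    constructor
    · rintro ⟨r, hr, rfl⟩
      positivity
    · intro hy
      refine ⟨Real.sqrt (y / 2), by positivity, ?_⟩
      rw [Real.sq_sqrt (by positivity)]
      ring
  have hinj : Set.InjOn (fun r : ℝ => 2 * r ^ 2) (Set.Ioi 0) := by
    intro a ha b hb hab
    simp only [Set.mem_Ioi] at ha hb hab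
    nlinarith [mul_pos ha hb, sq_nonneg (a - b)]
  have h := lintegral_image_eq_lintegral_abs_deriv_mul (s := Set.Ioi (0 : ℝ))
    (f := fun r => 2 * r ^ 2) (f' := fun r => 4 * r) measurableSet_Ioi
    (fun x _ => by
      have := ((hasDerivAt_pow 2 x).const_mul 2).hasDerivWithinAt (s := Set.Ioi (0 : ℝ))
      refine this.congr_deriv ?_
      push_cast; ring) hinj u
  rw [himg] at h
  rw [h]
  refine setLIntegral_congr_fun measurableSet_Ioi fun r hr => ?_
  simp only [Set.mem_Ioi] at hr
  simp only [abs_of_pos (show (0 : ℝ) < 4 * r by positivity)]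

lemma measurePreserving_radialMap :
    MeasurePreserving radialMap ((volume.restrict (Set.Ioi 0)).prod angleMeasure) volume := by
  refine ⟨continuous_radialMap.measurable, ?_⟩
  refine Measure.ext_of_lintegral _ fun u hu => ?_
  rw [lintegral_map hu continuous_radialMap.measurable,
    lintegral_prod (fun a => u (radialMap a))
      (hu.comp continuous_radialMap.measurable).aemeasurable,
    lintegral_Ioi_two_mul_sq, ← lintegral_comp_polarCoord_symm]
  have htarget : polarCoord.target = Set.Ioi (0 : ℝ) ×ˢ Set.Ioo (-Real.pi) Real.pi := rfl
  have hm : Measurable fun p : ℝ × ℝ => ENNReal.ofReal p.1 • u (polarCoord.symm p) := by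
    have : Measurable (fun p : ℝ × ℝ => polarCoord.symm p) := by
      simp only [polarCoord_symm_apply]
      fun_prop
    exact (measurable_fst.ennreal_ofReal).mul (hu.comp this)
  rw [htarget, Measure.volume_eq_prod, ← Measure.prod_restrict, lintegral_prod _ hm.aemeasurable]
  refine setLIntegral_congr_fun measurableSet_Ioi fun r hr => ?_
  simp only [Set.mem_Ioi] at hr
  have hs : Real.sqrt (2 * r ^ 2 / 2) = r := by
    rw [mul_div_cancel_left₀ _ (two_ne_zero), Real.sqrt_sq hr.le]
  have hmu : Measurable fun θ : ℝ => u (radialMap (2 * r ^ 2, θ)) := by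
    refine hu.comp (continuous_radialMap.measurable.comp ?_)
    fun_prop
  simp only [angleMeasure, lintegral_smul_measure, smul_eq_mul]
  rw [← mul_assoc, ← lintegral_const_mul _ hmu]
  have h4 : ENNReal.ofReal (4 * r) * 4⁻¹ = ENNReal.ofReal r := by
    rw [mul_comm 4 r, ENNReal.ofReal_mul hr.le, mul_assoc]
    norm_num
    rw [ENNReal.mul_inv_cancel (by norm_num) (by norm_num), mul_one]
  refine lintegral_congr fun θ => ?_
  rw [h4]
  simp only [radialMap, hs, polarCoord_symm_apply]

/-- The angular measure on the torus of angles. -/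
def angleMeasurePi (d : ℕ) : Measure (Fin d → ℝ) := Measure.pi fun _ => angleMeasure

instance (d : ℕ) : IsFiniteMeasure (angleMeasurePi d) := by
  unfold angleMeasurePi
  infer_instance

def radialMapPi {d : ℕ} (p : (Fin d → ℝ) × (Fin d → ℝ)) : (Fin d → ℝ) × (Fin d → ℝ) :=
  (fun l => Real.sqrt (p.1 l / 2) * Real.cos (p.2 l),
    fun l => Real.sqrt (p.1 l / 2) * Real.sin (p.2 l))

lemma Rpos_eq_pi (d : ℕ) : Rpos d = Set.univ.pi fun _ : Fin d => Set.Ioi (0 : ℝ) := by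
  ext x
  simp [Rpos]

lemma measurableSet_Rpos (d : ℕ) : MeasurableSet (Rpos d) := by
  rw [Rpos_eq_pi]
  exact MeasurableSet.univ_pi fun _ => measurableSet_Ioi

lemma volume_restrict_Rpos (d : ℕ) :
    (volume.restrict (Rpos d) : Measure (Fin d → ℝ)) =
      Measure.pi fun _ => volume.restrict (Set.Ioi (0 : ℝ)) := by
  rw [Rpos_eq_pi, volume_pi, Measure.restrict_pi_pi]

lemma measurePreserving_radialMapPi (d : ℕ) :
    MeasurePreserving (radialMapPi (d := d))
      ((volume.restrict (Rpos d)).prod (angleMeasurePi d)) volume := by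
  have h1 := measurePreserving_arrowProdEquivProdArrow ℝ ℝ (Fin d)
    (fun _ => volume.restrict (Set.Ioi (0 : ℝ))) (fun _ => angleMeasure)
  have h2 := measurePreserving_pi
    (fun _ : Fin d => (volume.restrict (Set.Ioi (0 : ℝ))).prod angleMeasure)
    (fun _ => (volume : Measure (ℝ × ℝ))) (fun _ => measurePreserving_radialMap)
  have h3 := volume_measurePreserving_arrowProdEquivProdArrow ℝ ℝ (Fin d)
  rw [← volume_pi] at h2
  rw [volume_restrict_Rpos]
  exact h3.comp (h2.comp h1.symm)

/-! ### Symbols in the class `IsSPlus` -/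

lemma foldr_comp_replicate_id {α : Type*} : ∀ n : ℕ,
    (List.replicate n (id : α → α)).foldr (· ∘ ·) id = id
  | 0 => rfl
  | n + 1 => by
    rw [List.replicate_succ, List.foldr_cons, foldr_comp_replicate_id n]
    rfl

lemma mderiv_zero {d : ℕ} (f : (Fin d → ℝ) → ℂ) : mderiv 0 f = f := by
  have h : (List.ofFn fun i : Fin d =>
      (fun g : (Fin d → ℝ) → ℂ => (pd i)^[(0 : Fin d → ℕ) i] g)) = List.replicate d id := by
    rw [← List.ofFn_const]
    rfl
  unfold mderiv
  rw [h, foldr_comp_replicate_id]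
  rfl

lemma IsSPlus.exists_weighted_bound {d : ℕ} {σ : (Fin d → ℝ) → ℂ} (hσ : IsSPlus σ) :
    ∃ C : ℝ, ∀ x ∈ Rpos d, (∏ i, (1 + x i ^ 2)) * ‖σ x‖ ≤ C := by
  choose C hC using fun s : Finset (Fin d) => hσ.2.2 (fun i => if i ∈ s then 2 else 0) 0
  refine ⟨∑ s : Finset (Fin d), C s, fun x hx => ?_⟩
  rw [Finset.prod_one_add, Finset.sum_mul, Finset.powerset_univ]
  refine Finset.sum_le_sum fun s _ => ?_
  have h := hC s x hx
  rw [mderiv_zero] at h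
  refine le_trans (le_of_eq ?_) h
  congr 1
  simp only [pow_ite, pow_zero]
  rw [Finset.prod_ite_mem, Finset.univ_inter]

lemma integrable_prod_inv_one_add_sq (d : ℕ) :
    Integrable (fun x : Fin d → ℝ => ∏ i, (1 + x i ^ 2)⁻¹) :=
  Integrable.fintype_prod (f := fun _ : Fin d => fun t : ℝ => (1 + t ^ 2)⁻¹)
    fun _ => integrable_inv_one_add_sq

lemma IsSPlus.exists_bound {d : ℕ} {σ : (Fin d → ℝ) → ℂ} (hσ : IsSPlus σ) :
    ∃ C : ℝ, 0 ≤ C ∧ ∀ x ∈ Rpos d, ‖σ x‖ ≤ C * ∏ i, (1 + x i ^ 2)⁻¹ := by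
  obtain ⟨C, hC⟩ := hσ.exists_weighted_bound
  refine ⟨|C|, abs_nonneg C, fun x hx => ?_⟩
  have hpos : 0 < ∏ i, (1 + x i ^ 2) := Finset.prod_pos fun i _ => by positivity
  rw [Finset.prod_inv_distrib, ← div_eq_mul_inv, le_div_iff₀ hpos, mul_comm]
  exact (hC x hx).trans (le_abs_self C)

lemma prod_inv_one_add_sq_le_one {d : ℕ} (x : Fin d → ℝ) : ∏ i, (1 + x i ^ 2)⁻¹ ≤ 1 :=
  Finset.prod_le_one (fun i _ => by positivity) fun i _ =>
    inv_le_one_of_one_le₀ (by nlinarith [sq_nonneg (x i)])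

lemma IsSPlus.aestronglyMeasurable {d : ℕ} {σ : (Fin d → ℝ) → ℂ} (hσ : IsSPlus σ) :
    AEStronglyMeasurable σ (volume.restrict (Rpos d)) :=
  hσ.1.continuousOn.aestronglyMeasurable (measurableSet_Rpos d)

lemma IsSPlus.integrableOn {d : ℕ} {σ : (Fin d → ℝ) → ℂ} (hσ : IsSPlus σ) :
    IntegrableOn σ (Rpos d) := by
  obtain ⟨C, hC0, hC⟩ := hσ.exists_bound
  refine Integrable.mono' (((integrable_prod_inv_one_add_sq d).const_mul C).integrableOn)
    hσ.aestronglyMeasurable ?_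
  exact (ae_restrict_iff' (measurableSet_Rpos d)).2 (Eventually.of_forall hC)

lemma IsSPlus.integrableOn_sq {d : ℕ} {σ : (Fin d → ℝ) → ℂ} (hσ : IsSPlus σ) :
    IntegrableOn (fun x => ‖σ x‖ ^ 2) (Rpos d) := by
  obtain ⟨C, hC0, hC⟩ := hσ.exists_bound
  refine Integrable.mono' (hσ.integrableOn.norm.const_mul C)
    (hσ.aestronglyMeasurable.norm.pow 2) ?_
  refine (ae_restrict_iff' (measurableSet_Rpos d)).2 (Eventually.of_forall fun x hx => ?_)
  have h : ‖σ x‖ ≤ C := (hC x hx).trans (mul_le_of_le_one_right hC0 (prod_inv_one_add_sq_le_one x))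
  rw [Real.norm_of_nonneg (by positivity), pow_two]
  gcongr

lemma integral_LagFun0_sq {d : ℕ} (k : Fin d → ℕ) : ∫ ρ in Rpos d, LagFun0 k ρ ^ 2 = 1 := by
  simp only [volume_restrict_Rpos, LagFun0, ← Finset.prod_pow]
  rw [integral_fintype_prod_eq_prod (fun l t => lagFun0 (k l) t ^ 2)]
  simp [integral_lagFun0_sq]

lemma integrableOn_LagFun0_sq {d : ℕ} (k : Fin d → ℕ) :
    IntegrableOn (fun ρ => LagFun0 k ρ ^ 2) (Rpos d) := by
  simp only [IntegrableOn, volume_restrict_Rpos, LagFun0, ← Finset.prod_pow]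
  exact Integrable.fintype_prod fun l => integrableOn_lagFun0_sq (k l)

lemma continuous_LagFun0 {d : ℕ} (k : Fin d → ℕ) : Continuous (LagFun0 k) :=
  continuous_finsetProd _ fun l _ => (continuous_lagFun0 (k l)).comp (continuous_apply l)

/-- The Laguerre coefficients of a symbol are bounded. -/
lemma IsSPlus.exists_bound_lagCoeff {d : ℕ} {σ : (Fin d → ℝ) → ℂ} (hσ : IsSPlus σ) :
    ∃ M : ℝ, 0 ≤ M ∧ ∀ k : Fin d → ℕ, ‖∫ ρ in Rpos d, σ ρ * ((LagFun0 k ρ : ℝ) : ℂ)‖ ≤ M := by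
  refine ⟨((∫ ρ in Rpos d, ‖σ ρ‖ ^ 2) + 1) / 2, by positivity, fun k => ?_⟩
  calc ‖∫ ρ in Rpos d, σ ρ * ((LagFun0 k ρ : ℝ) : ℂ)‖
      ≤ ∫ ρ in Rpos d, (‖σ ρ‖ ^ 2 + LagFun0 k ρ ^ 2) / 2 := by
        refine norm_integral_le_of_norm_le
          ((hσ.integrableOn_sq.add (integrableOn_LagFun0_sq k)).div_const 2)
          (Eventually.of_forall fun ρ => ?_)
        rw [norm_mul, Complex.norm_real, Real.norm_eq_abs, ← sq_abs (LagFun0 k ρ)]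
        nlinarith [sq_nonneg (‖σ ρ‖ - |LagFun0 k ρ|)]
    _ = ((∫ ρ in Rpos d, ‖σ ρ‖ ^ 2) + 1) / 2 := by
        rw [integral_div, integral_add hσ.integrableOn_sq (integrableOn_LagFun0_sq k),
          integral_LagFun0_sq]

/-! ### Symbols on phase space -/

def phaseSymbol {d : ℕ} (σb : (Fin d → ℝ) → ℂ) (z : (Fin d → ℝ) × (Fin d → ℝ)) : ℂ :=
  σb fun l => 2 * ((z.1 l) ^ 2 + (z.2 l) ^ 2)

lemma continuous_phaseSymbol {d : ℕ} {σb : (Fin d → ℝ) → ℂ}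
    (hσb : ContinuousOn σb {x | ∀ i, 0 ≤ x i}) : Continuous (phaseSymbol σb) :=
  hσb.comp_continuous (by fun_prop) fun z i => by positivity

lemma phaseSymbol_radialMapPi {d : ℕ} (σb : (Fin d → ℝ) → ℂ) {ρ : Fin d → ℝ} (hρ : ρ ∈ Rpos d)
    (θ : Fin d → ℝ) : phaseSymbol σb (radialMapPi (ρ, θ)) = σb ρ := by
  unfold phaseSymbol radialMapPi
  congr 1
  ext l
  have h := hρ l
  have hs : Real.sqrt (ρ l / 2) ^ 2 = ρ l / 2 := Real.sq_sqrt (by positivity)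
  simp only [mul_pow, hs]
  rw [← mul_add, Real.cos_sq_add_sin_sq]
  ring

lemma ae_mem_Rpos (d : ℕ) :
    ∀ᵐ p ∂((volume.restrict (Rpos d)).prod (angleMeasurePi d)), p.1 ∈ Rpos d :=
  Measure.quasiMeasurePreserving_fst.ae (ae_restrict_mem (measurableSet_Rpos d))

lemma integrable_phaseSymbol {d : ℕ} {σ σb : (Fin d → ℝ) → ℂ} (hσ : IsSPlus σ)
    (hσb : ContinuousOn σb {x | ∀ i, 0 ≤ x i}) (hext : ∀ x ∈ Rpos d, σb x = σ x) :
    Integrable (phaseSymbol σb) := by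
  have hmp := measurePreserving_radialMapPi d
  rw [← hmp.integrable_comp (continuous_phaseSymbol hσb).aestronglyMeasurable]
  have h : Integrable (fun p : (Fin d → ℝ) × (Fin d → ℝ) => σ p.1)
      ((volume.restrict (Rpos d)).prod (angleMeasurePi d)) := hσ.integrableOn.comp_fst _
  refine h.congr ?_
  filter_upwards [ae_mem_Rpos d] with p hp
  rw [Function.comp, ← hext _ hp, ← phaseSymbol_radialMapPi σb hp p.2]

/-! ### Density of Gaussian wave packets -/

open scoped FourierTransform ContDiff in
/-- An integrable function with vanishing Fourier transform vanishes almost everywhere. -/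
lemma ae_eq_zero_of_fourier_eq_zero {V : Type*} [NormedAddCommGroup V] [InnerProductSpace ℝ V]
    [FiniteDimensional ℝ V] [MeasurableSpace V] [BorelSpace V] {ψ : V → ℂ} (hψ : Integrable ψ)
    (h : ∀ w, 𝓕 ψ w = 0) : ∀ᵐ x, ψ x = 0 := by
  refine ae_eq_zero_of_integral_contDiff_smul_eq_zero hψ.locallyIntegrable fun g hg hgs => ?_
  have hs : HasCompactSupport fun x => (g x : ℂ) := hgs.comp_left Complex.ofReal_zero
  have hc : ContDiff ℝ ∞ fun x => (g x : ℂ) := Complex.ofRealCLM.contDiff.comp hg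
  set G : SchwartzMap V ℂ := hs.toSchwartzMap hc with hG
  have key := VectorFourier.integral_fourierIntegral_smul_eq_flip (L := innerₗ V)
    (μ := volume) (ν := volume) (f := (𝓕⁻ G : SchwartzMap V ℂ)) (g := ψ)
    Real.continuous_fourierChar continuous_inner (𝓕⁻ G : SchwartzMap V ℂ).integrable hψ
  have h0 : ∀ x, VectorFourier.fourierIntegral Real.fourierChar volume (innerₗ V).flip ψ x = 0 := by
    intro x
    rw [flip_innerₗ]
    exact h x
  have h1 : ∀ x, VectorFourier.fourierIntegral Real.fourierChar volume (innerₗ V)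
      (𝓕⁻ G : SchwartzMap V ℂ) x = (g x : ℂ) := by
    intro x
    have h2 : (𝓕 (𝓕⁻ G) : SchwartzMap V ℂ) = G := FourierTransform.fourier_fourierInv_eq G
    exact congrArg (fun u : SchwartzMap V ℂ => u x) h2
  simp only [h0, h1, smul_zero, integral_zero] at key
  simpa [Complex.real_smul] using key

/-- The tensor Gaussian wave packet. -/
def gaussWavePi {d : ℕ} (α : Fin d → ℝ) (x : Fin d → ℝ) : ℂ := ∏ l, gaussWave (α l) (x l)

lemma continuous_gaussWave (a : ℝ) : Continuous (gaussWave a) := by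
  unfold gaussWave
  fun_prop

lemma continuous_gaussWavePi {d : ℕ} (α : Fin d → ℝ) : Continuous (gaussWavePi α) :=
  continuous_finsetProd _ fun l _ => (continuous_gaussWave (α l)).comp (continuous_apply l)

lemma norm_gaussWave (a x : ℝ) : ‖gaussWave a x‖ = Real.exp (-x ^ 2 / 2) := by
  rw [gaussWave, Complex.norm_exp]
  congr 1
  simp [← Complex.ofReal_pow, neg_div]

lemma memLp_gaussWavePi {d : ℕ} (α : Fin d → ℝ) : MemLp (gaussWavePi α) 2 := by
  rw [memLp_two_iff_integrable_sq_norm (continuous_gaussWavePi α).aestronglyMeasurable]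
  simp only [gaussWavePi, norm_prod, ← Finset.prod_pow, norm_gaussWave]
  refine Integrable.fintype_prod (f := fun _ : Fin d => fun t : ℝ => Real.exp (-t ^ 2 / 2) ^ 2)
    fun _ => ?_
  refine (integrable_exp_neg_mul_sq one_pos).congr (Eventually.of_forall fun t => ?_)
  simp only [← Real.exp_nat_mul]
  congr 1
  push_cast; ring

abbrev L2Space (d : ℕ) := Lp ℂ 2 (volume : Measure (Fin d → ℝ))

def gaussWaveLp {d : ℕ} (α : Fin d → ℝ) : L2Space d :=
  (memLp_gaussWavePi α).toLp _

lemma coeFn_gaussWaveLp {d : ℕ} (α : Fin d → ℝ) :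
    (gaussWaveLp α : (Fin d → ℝ) → ℂ) =ᵐ[volume] gaussWavePi α :=
  (memLp_gaussWavePi α).coeFn_toLp

open scoped FourierTransform in
lemma span_gaussWaveLp_dense (d : ℕ) :
    Dense (Submodule.span ℂ (Set.range (gaussWaveLp (d := d))) : Set (L2Space d)) := by
  rw [Submodule.dense_iff_topologicalClosure_eq_top, Submodule.topologicalClosure_eq_top_iff,
    Submodule.eq_bot_iff]
  intro φ hφ
  have horth : ∀ α, ∫ x, (starRingEnd ℂ) (gaussWavePi α x) * φ x = 0 := by
    intro α
    have h1 := (Submodule.mem_orthogonal _ _).1 hφ (gaussWaveLp α)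
      (Submodule.subset_span ⟨α, rfl⟩)
    rw [L2.inner_def] at h1
    rw [← h1]
    refine integral_congr_ae ?_
    filter_upwards [coeFn_gaussWaveLp α] with x hx
    rw [hx, RCLike.inner_apply, mul_comm]
  set ψ : (Fin d → ℝ) → ℂ := fun x => gaussWavePi 0 x * φ x with hψ
  have hψint : Integrable ψ := (memLp_gaussWavePi 0).integrable_mul (Lp.memLp φ)
  have hcomp := PiLp.volume_preserving_ofLp (Fin d)
  have hψ'int : Integrable fun v : EuclideanSpace ℝ (Fin d) => ψ (WithLp.ofLp v) :=
    hcomp.integrable_comp_of_integrable hψint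
  have hemb : MeasurableEmbedding (WithLp.ofLp : EuclideanSpace ℝ (Fin d) → (Fin d → ℝ)) :=
    (MeasurableEquiv.toLp 2 (Fin d → ℝ)).symm.measurableEmbedding
  have hzero := ae_eq_zero_of_fourier_eq_zero hψ'int fun w => by
    rw [Real.fourier_eq']
    have h2 := hcomp.integral_comp hemb fun x : Fin d → ℝ =>
      Complex.exp ((-2 * Real.pi * ∑ l, w l * x l : ℝ) * Complex.I) * ψ x
    have h3 := horth fun l => 2 * Real.pi * w l
    rw [← h3]
    refine Eq.trans ?_ (h2.trans ?_)
    · refine integral_congr_ae (Eventually.of_forall fun v => ?_)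
      simp [PiLp.inner_apply]
    · refine integral_congr_ae (Eventually.of_forall fun x => ?_)
      simp only [hψ]
      rw [← mul_assoc]
      congr 1
      simp only [gaussWavePi, gaussWave, ← Complex.exp_sum, ← Complex.exp_add, ← Complex.exp_conj]
      congr 1
      push_cast
      simp only [map_sum, map_add, map_mul, map_div₀, map_neg, map_pow, Complex.conj_I,
        Complex.conj_ofReal, map_ofNat, Finset.mul_sum, Finset.sum_mul, ← Finset.sum_add_distrib]
      refine Finset.sum_congr rfl fun l _ => ?_
      simp only [Pi.zero_apply, Complex.ofReal_zero]
      ring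
  have hzero' : ∀ᵐ x : Fin d → ℝ, ψ x = 0 := by
    have h4 := (PiLp.volume_preserving_toLp (Fin d)).quasiMeasurePreserving.ae hzero
    simpa using h4
  rw [Lp.eq_zero_iff_ae_eq_zero]
  filter_upwards [hzero'] with x hx
  have hne : gaussWavePi (0 : Fin d → ℝ) x ≠ 0 :=
    Finset.prod_ne_zero_iff.2 fun l _ => Complex.exp_ne_zero _
  simpa [hψ, hne] using hx

/-! ### The Wigner transform on square integrable functions -/

lemma quasiMeasurePreserving_add_smul {d : ℕ} (x : Fin d → ℝ) {c : ℝ} (hc : c ≠ 0) :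
    Measure.QuasiMeasurePreserving (fun p : Fin d → ℝ => x + c • p) volume volume := by
  have h1 : Measure.QuasiMeasurePreserving (fun p : Fin d → ℝ => c • p) volume volume := by
    refine ⟨measurable_const_smul c, ?_⟩
    rw [Measure.map_addHaar_smul _ hc]
    exact Measure.smul_absolutelyContinuous
  exact (measurePreserving_add_left volume x).quasiMeasurePreserving.comp h1

lemma integrable_comp_add_smul {d : ℕ} {u : (Fin d → ℝ) → ℝ} (hu : Integrable u)
    (x : Fin d → ℝ) {c : ℝ} (hc : c ≠ 0) : Integrable fun p => u (x + c • p) :=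
  (integrable_comp_smul_iff volume (fun p => u (x + p)) hc).2 (hu.comp_add_left x)

lemma integral_comp_add_smul {d : ℕ} (u : (Fin d → ℝ) → ℝ) (x : Fin d → ℝ) (c : ℝ) :
    ∫ p, u (x + c • p) = |(c ^ d)⁻¹| * ∫ p, u p := by
  rw [Measure.integral_comp_smul volume (fun p => u (x + p)) c, integral_add_left_eq_self]
  simp

/-- The integrand of the Wigner transform. -/
def wigIntegrand {d : ℕ} (F G : (Fin d → ℝ) → ℂ) (x ξ p : Fin d → ℝ) : ℂ :=
  Complex.exp (-Complex.I * ((∑ l, ξ l * p l : ℝ) : ℂ)) *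
    F (x + (2⁻¹ : ℝ) • p) * G (x + (-2⁻¹ : ℝ) • p)

lemma Wig_eq {d : ℕ} (F G : (Fin d → ℝ) → ℂ) (x ξ : Fin d → ℝ) :
    Wig F G x ξ = (((2 * Real.pi) ^ (-(d : ℝ) / 2) : ℝ) : ℂ) * ∫ p, wigIntegrand F G x ξ p := by
  have h1 : ∀ p : Fin d → ℝ, (fun l => x l + p l / 2) = x + (2⁻¹ : ℝ) • p := fun p => by
    ext l
    simp only [Pi.add_apply, Pi.smul_apply, smul_eq_mul]
    ring
  have h2 : ∀ p : Fin d → ℝ, (fun l => x l - p l / 2) = x + (-2⁻¹ : ℝ) • p := fun p => by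
    ext l
    simp only [Pi.add_apply, Pi.smul_apply, smul_eq_mul]
    ring
  simp only [Wig, wigIntegrand, h1, h2]

lemma norm_wigIntegrand_le {d : ℕ} (F G : (Fin d → ℝ) → ℂ) (x ξ p : Fin d → ℝ) :
    ‖wigIntegrand F G x ξ p‖ ≤
      (‖F (x + (2⁻¹ : ℝ) • p)‖ ^ 2 + ‖G (x + (-2⁻¹ : ℝ) • p)‖ ^ 2) / 2 := by
  have h : ‖Complex.exp (-Complex.I * ((∑ l, ξ l * p l : ℝ) : ℂ))‖ = 1 := by
    rw [Complex.norm_exp]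
    simp
  rw [wigIntegrand, norm_mul, norm_mul, h, one_mul]
  nlinarith [sq_nonneg (‖F (x + (2⁻¹ : ℝ) • p)‖ - ‖G (x + (-2⁻¹ : ℝ) • p)‖)]

lemma aestronglyMeasurable_wigIntegrand {d : ℕ} {F G : (Fin d → ℝ) → ℂ}
    (hF : AEStronglyMeasurable F) (hG : AEStronglyMeasurable G) (x ξ : Fin d → ℝ) :
    AEStronglyMeasurable (wigIntegrand F G x ξ) := by
  refine (AEStronglyMeasurable.mul ?_ ?_).mul ?_
  · exact Continuous.aestronglyMeasurable (by fun_prop)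
  · exact hF.comp_quasiMeasurePreserving (quasiMeasurePreserving_add_smul x (by norm_num))
  · exact hG.comp_quasiMeasurePreserving (quasiMeasurePreserving_add_smul x (by norm_num))

lemma integrable_wigIntegrand_bound {d : ℕ} {F G : (Fin d → ℝ) → ℂ} (hF : MemLp F 2)
    (hG : MemLp G 2) (x : Fin d → ℝ) :
    Integrable fun p =>
      (‖F (x + (2⁻¹ : ℝ) • p)‖ ^ 2 + ‖G (x + (-2⁻¹ : ℝ) • p)‖ ^ 2) / 2 :=
  ((integrable_comp_add_smul hF.norm.integrable_sq x (by norm_num)).add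
    (integrable_comp_add_smul hG.norm.integrable_sq x (by norm_num))).div_const 2

lemma integrable_wigIntegrand {d : ℕ} {F G : (Fin d → ℝ) → ℂ} (hF : MemLp F 2)
    (hG : MemLp G 2) (x ξ : Fin d → ℝ) : Integrable (wigIntegrand F G x ξ) :=
  (integrable_wigIntegrand_bound hF hG x).mono'
    (aestronglyMeasurable_wigIntegrand hF.1 hG.1 x ξ)
    (Eventually.of_forall (norm_wigIntegrand_le F G x ξ))

lemma exists_norm_Wig_le (d : ℕ) :
    ∃ K : ℝ, 0 ≤ K ∧ ∀ F G : (Fin d → ℝ) → ℂ, MemLp F 2 → MemLp G 2 → ∀ x ξ,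
      ‖Wig F G x ξ‖ ≤ K * ((∫ p, ‖F p‖ ^ 2) + ∫ p, ‖G p‖ ^ 2) := by
  refine ⟨(2 * Real.pi) ^ (-(d : ℝ) / 2) * (2 ^ d / 2), by positivity, fun F G hF hG x ξ => ?_⟩
  have hpos : (0 : ℝ) ≤ (2 * Real.pi) ^ (-(d : ℝ) / 2) := by positivity
  rw [Wig_eq, norm_mul, Complex.norm_real, Real.norm_of_nonneg hpos, mul_assoc]
  refine mul_le_mul_of_nonneg_left ?_ hpos
  refine (norm_integral_le_of_norm_le (integrable_wigIntegrand_bound hF hG x)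
    (Eventually.of_forall (norm_wigIntegrand_le F G x ξ))).trans (le_of_eq ?_)
  rw [integral_div, integral_add
    (integrable_comp_add_smul hF.norm.integrable_sq x (by norm_num))
    (integrable_comp_add_smul hG.norm.integrable_sq x (by norm_num)),
    integral_comp_add_smul (fun p => ‖F p‖ ^ 2), integral_comp_add_smul (fun p => ‖G p‖ ^ 2)]
  have h1 : |((2⁻¹ : ℝ) ^ d)⁻¹| = 2 ^ d := by
    rw [abs_of_pos (by positivity)]
    simp
  have h2 : |((-2⁻¹ : ℝ) ^ d)⁻¹| = 2 ^ d := by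
    rw [abs_inv, abs_pow, abs_neg, abs_of_pos (by positivity)]
    simp
  rw [h1, h2]
  ring

lemma Wig_congr_ae {d : ℕ} {F F' G G' : (Fin d → ℝ) → ℂ} (hF : F =ᵐ[volume] F')
    (hG : G =ᵐ[volume] G') (x ξ : Fin d → ℝ) : Wig F G x ξ = Wig F' G' x ξ := by
  rw [Wig_eq, Wig_eq]
  congr 1
  refine integral_congr_ae ?_
  filter_upwards [(quasiMeasurePreserving_add_smul x (c := 2⁻¹) (by norm_num)).ae hF,
    (quasiMeasurePreserving_add_smul x (c := -2⁻¹) (by norm_num)).ae hG] with p hp1 hp2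
  rw [wigIntegrand, wigIntegrand, hp1, hp2]

lemma Wig_add_left {d : ℕ} {F F' G : (Fin d → ℝ) → ℂ} (hF : MemLp F 2) (hF' : MemLp F' 2)
    (hG : MemLp G 2) (x ξ : Fin d → ℝ) :
    Wig (F + F') G x ξ = Wig F G x ξ + Wig F' G x ξ := by
  simp only [Wig_eq]
  rw [← mul_add, ← integral_add (integrable_wigIntegrand hF hG x ξ)
    (integrable_wigIntegrand hF' hG x ξ)]
  congr 2
  ext p
  simp only [wigIntegrand, Pi.add_apply]
  ring

lemma Wig_add_right {d : ℕ} {F G G' : (Fin d → ℝ) → ℂ} (hF : MemLp F 2) (hG : MemLp G 2)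
    (hG' : MemLp G' 2) (x ξ : Fin d → ℝ) :
    Wig F (G + G') x ξ = Wig F G x ξ + Wig F G' x ξ := by
  simp only [Wig_eq]
  rw [← mul_add, ← integral_add (integrable_wigIntegrand hF hG x ξ)
    (integrable_wigIntegrand hF hG' x ξ)]
  congr 2
  ext p
  simp only [wigIntegrand, Pi.add_apply]
  ring

lemma Wig_smul_left {d : ℕ} (c : ℂ) (F G : (Fin d → ℝ) → ℂ) (x ξ : Fin d → ℝ) :
    Wig (c • F) G x ξ = c * Wig F G x ξ := by
  simp only [Wig_eq]
  rw [mul_left_comm, ← integral_const_mul c]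
  congr 2
  ext p
  simp only [wigIntegrand, Pi.smul_apply, smul_eq_mul]
  ring

lemma Wig_smul_right {d : ℕ} (c : ℂ) (F G : (Fin d → ℝ) → ℂ) (x ξ : Fin d → ℝ) :
    Wig F (c • G) x ξ = c * Wig F G x ξ := by
  simp only [Wig_eq]
  rw [mul_left_comm, ← integral_const_mul c]
  congr 2
  ext p
  simp only [wigIntegrand, Pi.smul_apply, smul_eq_mul]
  ring

lemma stronglyMeasurable_Wig {d : ℕ} {F G : (Fin d → ℝ) → ℂ} (hF : StronglyMeasurable F)
    (hG : StronglyMeasurable G) :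
    StronglyMeasurable fun z : (Fin d → ℝ) × (Fin d → ℝ) => Wig F G z.1 z.2 := by
  simp only [Wig_eq]
  refine StronglyMeasurable.const_mul ?_ _
  refine StronglyMeasurable.integral_prod_right
    (f := fun (z : (Fin d → ℝ) × (Fin d → ℝ)) p => wigIntegrand F G z.1 z.2 p) ?_
  refine (StronglyMeasurable.mul ?_ ?_).mul ?_
  · exact Continuous.stronglyMeasurable (by fun_prop)
  · exact hF.comp_measurable (Continuous.measurable (by fun_prop))
  · exact hG.comp_measurable (Continuous.measurable (by fun_prop))

/-! ### Two bounded bilinear forms -/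

/-- A quadratic bound for a bilinear form on a normed space yields boundedness. -/
lemma norm_bilin_le_of_quadratic_bound {H : Type*} [NormedAddCommGroup H] [NormedSpace ℂ H]
    (T : H →ₗ[ℂ] H →ₗ[ℂ] ℂ) (C : ℝ) (hT : ∀ F G, ‖T F G‖ ≤ C * (‖F‖ ^ 2 + ‖G‖ ^ 2)) (F G : H) :
    ‖T F G‖ ≤ 2 * C * ‖F‖ * ‖G‖ := by
  by_cases hF : F = 0
  · simp [hF]
  by_cases hG : G = 0
  · simp [hG]
  have hF' : 0 < ‖F‖ := norm_pos_iff.2 hF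
  have hG' : 0 < ‖G‖ := norm_pos_iff.2 hG
  have h := hT ((‖F‖⁻¹ : ℂ) • F) ((‖G‖⁻¹ : ℂ) • G)
  simp only [map_smul, LinearMap.smul_apply, norm_smul, norm_inv, Complex.norm_real, norm_norm,
    inv_mul_cancel₀ hF'.ne', inv_mul_cancel₀ hG'.ne'] at h
  calc ‖T F G‖ = ‖F‖ * ‖G‖ * (‖G‖⁻¹ * (‖F‖⁻¹ * ‖T F G‖)) := by field_simp
    _ ≤ ‖F‖ * ‖G‖ * (C * (1 ^ 2 + 1 ^ 2)) := by gcongr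
    _ = 2 * C * ‖F‖ * ‖G‖ := by ring

lemma integral_norm_sq_eq {d : ℕ} (F : L2Space d) : ∫ p, ‖F p‖ ^ 2 = ‖F‖ ^ 2 := by
  rw [← inner_self_eq_norm_sq (𝕜 := ℂ) F, L2.inner_def, ← integral_re (L2.integrable_inner F F)]
  refine integral_congr_ae (Eventually.of_forall fun p => ?_)
  exact (inner_self_eq_norm_sq (𝕜 := ℂ) (F p)).symm

lemma integrable_mul_Wig {d : ℕ} {s : (Fin d → ℝ) × (Fin d → ℝ) → ℂ} (hs : Integrable s)
    (F G : L2Space d) : Integrable fun z => s z * Wig F G z.1 z.2 := by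
  obtain ⟨K, -, hK⟩ := exists_norm_Wig_le d
  exact hs.mul_bdd (stronglyMeasurable_Wig (Lp.stronglyMeasurable F)
    (Lp.stronglyMeasurable G)).aestronglyMeasurable
    (Eventually.of_forall fun z => hK F G (Lp.memLp F) (Lp.memLp G) z.1 z.2)

def weylForm {d : ℕ} {s : (Fin d → ℝ) × (Fin d → ℝ) → ℂ} (hs : Integrable s) :
    L2Space d →ₗ[ℂ] L2Space d →ₗ[ℂ] ℂ :=
  LinearMap.mk₂ ℂ (fun F G => ∫ z, s z * Wig F G z.1 z.2)
    (fun F F' G => by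
      rw [← integral_add (integrable_mul_Wig hs F G) (integrable_mul_Wig hs F' G)]
      congr 1
      ext z
      rw [Wig_congr_ae (Lp.coeFn_add F F') (ae_eq_refl _),
        Wig_add_left (Lp.memLp F) (Lp.memLp F') (Lp.memLp G), mul_add])
    (fun c F G => by
      rw [smul_eq_mul, ← integral_const_mul]
      congr 1
      ext z
      rw [Wig_congr_ae (Lp.coeFn_smul c F) (ae_eq_refl _), Wig_smul_left, mul_left_comm])
    (fun F G G' => by
      rw [← integral_add (integrable_mul_Wig hs F G) (integrable_mul_Wig hs F G')]
      congr 1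
      ext z
      rw [Wig_congr_ae (ae_eq_refl _) (Lp.coeFn_add G G'),
        Wig_add_right (Lp.memLp F) (Lp.memLp G) (Lp.memLp G'), mul_add])
    (fun c F G => by
      rw [smul_eq_mul, ← integral_const_mul]
      congr 1
      ext z
      rw [Wig_congr_ae (ae_eq_refl _) (Lp.coeFn_smul c G), Wig_smul_right, mul_left_comm])

lemma weylForm_apply {d : ℕ} {s : (Fin d → ℝ) × (Fin d → ℝ) → ℂ} (hs : Integrable s)
    (F G : L2Space d) : weylForm hs F G = ∫ z, s z * Wig F G z.1 z.2 := rfl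

lemma exists_norm_weylForm_le {d : ℕ} {s : (Fin d → ℝ) × (Fin d → ℝ) → ℂ} (hs : Integrable s) :
    ∃ C : ℝ, ∀ F G, ‖weylForm hs F G‖ ≤ C * (‖F‖ ^ 2 + ‖G‖ ^ 2) := by
  obtain ⟨K, hK0, hK⟩ := exists_norm_Wig_le d
  refine ⟨(∫ z, ‖s z‖) * K, fun F G => ?_⟩
  rw [weylForm_apply, mul_assoc, ← integral_mul_const]
  refine norm_integral_le_of_norm_le (hs.norm.mul_const _) (Eventually.of_forall fun z => ?_)
  rw [norm_mul]
  gcongr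
  have h := hK F G (Lp.memLp F) (Lp.memLp G) z.1 z.2
  rwa [integral_norm_sq_eq, integral_norm_sq_eq] at h

lemma memLp_HermFun {d : ℕ} (k : Fin d → ℕ) : MemLp (fun x => (HermFun k x : ℂ)) 2 := by
  have hc : Continuous fun x : Fin d → ℝ => (HermFun k x : ℂ) :=
    Complex.continuous_ofReal.comp (continuous_finsetProd _ fun l _ =>
      (continuous_hermFun (k l)).comp (continuous_apply l))
  rw [memLp_two_iff_integrable_sq_norm hc.aestronglyMeasurable]
  have h : Integrable fun x : Fin d → ℝ => ∏ l, hermFun (k l) (x l) * hermFun (k l) (x l) :=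
    Integrable.fintype_prod (f := fun (l : Fin d) t => hermFun (k l) t * hermFun (k l) t)
      fun l => integrable_hermFun_mul (k l) (k l)
  refine h.congr (Eventually.of_forall fun x => ?_)
  simp only [Complex.norm_real, Real.norm_eq_abs, HermFun, Finset.prod_mul_distrib, pow_two,
    abs_mul_abs_self]

def hermLp {d : ℕ} (k : Fin d → ℕ) : L2Space d := (memLp_HermFun k).toLp _

lemma coeFn_hermLp {d : ℕ} (k : Fin d → ℕ) :
    (hermLp k : (Fin d → ℝ) → ℂ) =ᵐ[volume] fun x => (HermFun k x : ℂ) :=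
  (memLp_HermFun k).coeFn_toLp

lemma inner_hermLp {d : ℕ} (k : Fin d → ℕ) (F : L2Space d) :
    inner ℂ (hermLp k) F = ∫ x, F x * (HermFun k x : ℂ) := by
  rw [L2.inner_def]
  refine integral_congr_ae ?_
  filter_upwards [coeFn_hermLp k] with x hx
  rw [hx, RCLike.inner_apply, Complex.conj_ofReal]

lemma orthonormal_hermLp (d : ℕ) : Orthonormal ℂ (hermLp (d := d)) := by
  rw [orthonormal_iff_ite]
  intro j k
  rw [inner_hermLp]
  have h1 : ∫ x, (hermLp k : (Fin d → ℝ) → ℂ) x * (HermFun j x : ℂ) =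
      ((∫ x : Fin d → ℝ, ∏ l, hermFun (k l) (x l) * hermFun (j l) (x l) : ℝ) : ℂ) := by
    rw [← integral_complex_ofReal]
    refine integral_congr_ae ?_
    filter_upwards [coeFn_hermLp k] with x hx
    rw [hx, Finset.prod_mul_distrib, ← Complex.ofReal_mul, HermFun, HermFun]
  rw [h1, integral_fintype_prod_volume_eq_prod (fun l t => hermFun (k l) t * hermFun (j l) t)]
  simp only [integral_hermFun_mul, Finset.prod_ite_zero, Finset.prod_const_one, Finset.mem_univ,
    forall_true_left, eq_comm (a := j), funext_iff]
  split_ifs <;> simp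

lemma summable_norm_inner_hermLp_sq {d : ℕ} (F : L2Space d) :
    Summable fun k => ‖inner ℂ (hermLp k) F‖ ^ 2 :=
  (orthonormal_hermLp d).inner_products_summable F

lemma norm_diag_term_le {d : ℕ} {a : (Fin d → ℕ) → ℂ} {M : ℝ} (hM : ∀ k, ‖a k‖ ≤ M)
    (F G : L2Space d) (k : Fin d → ℕ) :
    ‖a k * inner ℂ (hermLp k) F * inner ℂ (hermLp k) G‖ ≤
      M / 2 * (‖inner ℂ (hermLp k) F‖ ^ 2 + ‖inner ℂ (hermLp k) G‖ ^ 2) := by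
  have hM0 : 0 ≤ M := (norm_nonneg _).trans (hM k)
  rw [norm_mul, norm_mul, mul_assoc]
  have h := sq_nonneg (‖inner ℂ (hermLp k) F‖ - ‖inner ℂ (hermLp k) G‖)
  calc ‖a k‖ * (‖inner ℂ (hermLp k) F‖ * ‖inner ℂ (hermLp k) G‖)
      ≤ M * (‖inner ℂ (hermLp k) F‖ * ‖inner ℂ (hermLp k) G‖) := by
        gcongr
        exact hM k
    _ ≤ _ := by nlinarith

lemma summable_norm_diag {d : ℕ} {a : (Fin d → ℕ) → ℂ} {M : ℝ} (hM : ∀ k, ‖a k‖ ≤ M)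
    (F G : L2Space d) :
    Summable fun k => ‖a k * inner ℂ (hermLp k) F * inner ℂ (hermLp k) G‖ :=
  Summable.of_nonneg_of_le (fun _ => norm_nonneg _) (norm_diag_term_le hM F G)
    (((summable_norm_inner_hermLp_sq F).add (summable_norm_inner_hermLp_sq G)).mul_left _)

/-- The bilinear form that is diagonal in the Hermite basis with coefficients `a`. -/
def diagForm {d : ℕ} {a : (Fin d → ℕ) → ℂ} {M : ℝ} (hM : ∀ k, ‖a k‖ ≤ M) :
    L2Space d →ₗ[ℂ] L2Space d →ₗ[ℂ] ℂ :=
  LinearMap.mk₂ ℂ (fun F G => ∑' k, a k * inner ℂ (hermLp k) F * inner ℂ (hermLp k) G)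
    (fun F F' G => by
      rw [← (summable_norm_diag hM F G).of_norm.tsum_add (summable_norm_diag hM F' G).of_norm]
      congr 1
      ext k
      rw [inner_add_right]
      ring)
    (fun c F G => by
      rw [smul_eq_mul, ← tsum_mul_left]
      congr 1
      ext k
      rw [inner_smul_right]
      ring)
    (fun F G G' => by
      rw [← (summable_norm_diag hM F G).of_norm.tsum_add (summable_norm_diag hM F G').of_norm]
      congr 1
      ext k
      rw [inner_add_right]
      ring)
    (fun c F G => by
      rw [smul_eq_mul, ← tsum_mul_left]
      congr 1
      ext k
      rw [inner_smul_right]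
      ring)

lemma diagForm_apply {d : ℕ} {a : (Fin d → ℕ) → ℂ} {M : ℝ} (hM : ∀ k, ‖a k‖ ≤ M)
    (F G : L2Space d) :
    diagForm hM F G = ∑' k, a k * inner ℂ (hermLp k) F * inner ℂ (hermLp k) G := rfl

lemma exists_norm_diagForm_le {d : ℕ} {a : (Fin d → ℕ) → ℂ} {M : ℝ} (hM : ∀ k, ‖a k‖ ≤ M) :
    ∃ C : ℝ, ∀ F G, ‖diagForm hM F G‖ ≤ C * (‖F‖ ^ 2 + ‖G‖ ^ 2) := by
  have hM0 : 0 ≤ M := (norm_nonneg _).trans (hM 0)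
  refine ⟨M / 2, fun F G => ?_⟩
  have hF := summable_norm_inner_hermLp_sq F
  have hG := summable_norm_inner_hermLp_sq G
  rw [diagForm_apply]
  refine (tsum_of_norm_bounded ((hF.add hG).mul_left (M / 2)).hasSum
    (norm_diag_term_le hM F G)).trans ?_
  rw [tsum_mul_left, hF.tsum_add hG]
  gcongr
  · exact (orthonormal_hermLp d).tsum_inner_products_le F
  · exact (orthonormal_hermLp d).tsum_inner_products_le G

/-- Bounded bilinear forms agreeing on Gaussian wave packets are equal. -/
lemma bilin_eq_of_eq_gaussWaveLp {d : ℕ} {S T : L2Space d →ₗ[ℂ] L2Space d →ₗ[ℂ] ℂ}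
    (hS : ∃ C : ℝ, ∀ F G, ‖S F G‖ ≤ C * (‖F‖ ^ 2 + ‖G‖ ^ 2))
    (hT : ∃ C : ℝ, ∀ F G, ‖T F G‖ ≤ C * (‖F‖ ^ 2 + ‖G‖ ^ 2))
    (h : ∀ α β, S (gaussWaveLp α) (gaussWaveLp β) = T (gaussWaveLp α) (gaussWaveLp β)) :
    S = T := by
  obtain ⟨C, hC⟩ := hS
  obtain ⟨C', hC'⟩ := hT
  let S' := S.mkContinuous₂ _ (norm_bilin_le_of_quadratic_bound S C hC)
  let T' := T.mkContinuous₂ _ (norm_bilin_le_of_quadratic_bound T C' hC')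
  have hdense := span_gaussWaveLp_dense d
  have h1 : ∀ α, S' (gaussWaveLp α) = T' (gaussWaveLp α) := fun α =>
    ContinuousLinearMap.ext_on hdense (by rintro _ ⟨β, rfl⟩; exact h α β)
  have h2 : S' = T' := ContinuousLinearMap.ext_on hdense (by rintro _ ⟨α, rfl⟩; exact h1 α)
  refine LinearMap.ext fun F => LinearMap.ext fun G => ?_
  exact congrArg (fun U : L2Space d →L[ℂ] L2Space d →L[ℂ] ℂ => U F G) h2

/-! ### Gaussian wave packets: both bilinear forms -/

lemma inner_hermLp_gaussWaveLp {d : ℕ} (k : Fin d → ℕ) (α : Fin d → ℝ) :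
    inner ℂ (hermLp k) (gaussWaveLp α) = ∏ l, ∫ x, gaussWave (α l) x * (hermFun (k l) x : ℂ) := by
  rw [inner_hermLp, ← integral_fintype_prod_volume_eq_prod
    (fun l x => gaussWave (α l) x * (hermFun (k l) x : ℂ))]
  refine integral_congr_ae ?_
  filter_upwards [coeFn_gaussWaveLp α] with x hx
  rw [hx, gaussWavePi, HermFun, Complex.ofReal_prod, Finset.prod_mul_distrib]

lemma inner_hermLp_gaussWaveLp_mul {d : ℕ} (k : Fin d → ℕ) (α β : Fin d → ℝ) :
    (-1 : ℂ) ^ (∑ l, k l) * inner ℂ (hermLp k) (gaussWaveLp α) *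
        inner ℂ (hermLp k) (gaussWaveLp β) =
      (∏ l, (Real.sqrt Real.pi * Complex.exp (-((α l : ℂ) ^ 2 + (β l : ℂ) ^ 2) / 4))) *
        ∏ l, ((α l * β l / 2 : ℂ) ^ k l / (k l).factorial) := by
  rw [inner_hermLp_gaussWaveLp, inner_hermLp_gaussWaveLp, mul_assoc, ← Finset.prod_mul_distrib,
    ← Finset.prod_mul_distrib, ← Finset.prod_pow_eq_pow_sum, ← Finset.prod_mul_distrib]
  refine Finset.prod_congr rfl fun l _ => ?_
  rw [integral_gaussWave_mul_gaussWave_hermFun, neg_pow (α l * β l / 2 : ℂ)]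
  have h : ((-1 : ℂ) ^ k l) * (-1) ^ k l = 1 := by rw [← mul_pow]; simp
  linear_combination (Real.sqrt Real.pi * Complex.exp (-((α l : ℂ) ^ 2 + (β l : ℂ) ^ 2) / 4) *
    ((α l * β l / 2 : ℂ) ^ k l / (k l).factorial)) * h

def waveWigner (a b : ℝ) (q : ℝ × ℝ) : ℂ :=
  2 * Real.sqrt Real.pi * Complex.exp (-((q.1 : ℂ) ^ 2 + (q.2 : ℂ) ^ 2) +
    Complex.I * a * (q.1 - Complex.I * q.2) + Complex.I * b * (q.1 + Complex.I * q.2) -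
    ((a : ℂ) ^ 2 + (b : ℂ) ^ 2) / 4 + a * b / 2)

lemma integral_gaussWave_wigner (a b x ξ : ℝ) :
    ∫ p : ℝ, Complex.exp (-Complex.I * (ξ * p)) * gaussWave a (x + 2⁻¹ * p) *
      gaussWave b (x + -2⁻¹ * p) = waveWigner a b (x, ξ) := by
  have h := integral_cexp_quadratic (b := (-1 / 4 : ℂ)) (by norm_num)
    (Complex.I * ((a - b) / 2 - ξ)) (-(x : ℂ) ^ 2 + Complex.I * (a + b) * x)
  have hpi : ((Real.pi : ℂ) / -(-1 / 4)) ^ (1 / 2 : ℂ) = 2 * Real.sqrt Real.pi := by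
    have h1 : ((Real.pi : ℂ) / -(-1 / 4)) = ((4 * Real.pi : ℝ) : ℂ) := by push_cast; ring
    have h2 : (1 / 2 : ℂ) = ((1 / 2 : ℝ) : ℂ) := by push_cast; ring
    rw [h1, h2, ← Complex.ofReal_cpow (by positivity), ← Real.sqrt_eq_rpow,
      Real.sqrt_mul (by norm_num), show (4 : ℝ) = 2 ^ 2 by norm_num, Real.sqrt_sq (by norm_num)]
    push_cast
    rfl
  rw [hpi] at h
  refine Eq.trans ?_ (h.trans ?_)
  · refine integral_congr_ae (Eventually.of_forall fun p => ?_)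
    simp only [gaussWave, ← Complex.exp_add]
    congr 1
    push_cast
    ring
  · rw [waveWigner]
    congr 2
    linear_combination ((((a : ℂ) - b) / 2 - ξ) ^ 2 + a * ξ - b * ξ) * Complex.I_sq

lemma Wig_gaussWavePi {d : ℕ} (α β x ξ : Fin d → ℝ) :
    Wig (gaussWavePi α) (gaussWavePi β) x ξ =
      (((2 * Real.pi) ^ (-(d : ℝ) / 2) : ℝ) : ℂ) * ∏ l, waveWigner (α l) (β l) (x l, ξ l) := by
  rw [Wig_eq]
  congr 1
  simp only [← integral_gaussWave_wigner]
  rw [← integral_fintype_prod_volume_eq_prod (fun l (p : ℝ) =>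
    Complex.exp (-Complex.I * (ξ l * p)) * gaussWave (α l) (x l + 2⁻¹ * p) *
      gaussWave (β l) (x l + -2⁻¹ * p))]
  refine integral_congr_ae (Eventually.of_forall fun p => ?_)
  simp only [wigIntegrand, gaussWavePi, Finset.prod_mul_distrib, ← Complex.exp_sum,
    ← Finset.mul_sum, Pi.add_apply, Pi.smul_apply, smul_eq_mul, Complex.ofReal_sum,
    Complex.ofReal_mul]

lemma integral_waveWigner_radialMap (a b : ℝ) {ρ : ℝ} (hρ : 0 < ρ) :
    ∫ θ, waveWigner a b (radialMap (ρ, θ)) ∂angleMeasure =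
      Real.pi * Real.sqrt Real.pi * Complex.exp (-((a : ℂ) ^ 2 + (b : ℂ) ^ 2) / 4) *
        ∑' n : ℕ, (a * b / 2 : ℂ) ^ n / n.factorial * (lagFun0 n ρ : ℂ) := by
  have hs : ((Real.sqrt (ρ / 2) : ℝ) : ℂ) ^ 2 = ρ / 2 := by
    rw [← Complex.ofReal_pow, Real.sq_sqrt (by positivity)]
    push_cast
    rfl
  have h1 : ∀ θ : ℝ, waveWigner a b (radialMap (ρ, θ)) =
      2 * Real.sqrt Real.pi * Complex.exp (-((a : ℂ) ^ 2 + (b : ℂ) ^ 2) / 4) *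
        (Complex.exp (-(ρ : ℂ) / 2) * Complex.exp (a * b / 2)) *
        Complex.exp ((Complex.I * a * Real.sqrt (ρ / 2)) * Complex.exp (-(Complex.I * θ)) +
          (Complex.I * b * Real.sqrt (ρ / 2)) * Complex.exp (Complex.I * θ)) := by
    intro θ
    have hexp : Complex.exp (Complex.I * θ) = Complex.cos θ + Complex.I * Complex.sin θ := by
      rw [mul_comm, Complex.exp_mul_I]
      ring
    have hexp' : Complex.exp (-(Complex.I * θ)) = Complex.cos θ - Complex.I * Complex.sin θ := by
      rw [show -(Complex.I * θ) = (-θ : ℂ) * Complex.I by ring, Complex.exp_mul_I,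
        Complex.cos_neg, Complex.sin_neg]
      ring
    have hcs := Complex.cos_sq_add_sin_sq (θ : ℂ)
    rw [hexp, hexp']
    simp only [waveWigner, radialMap, mul_assoc, ← Complex.exp_add]
    congr 3
    push_cast
    linear_combination (-((Real.sqrt (ρ / 2) : ℝ) : ℂ) ^ 2) * hcs - hs
  simp only [h1]
  rw [integral_const_mul, angleMeasure, integral_smul_measure, integral_Ioo_exp_add,
    tsum_lagFun0_genFun]
  have h2 : Complex.I * a * Real.sqrt (ρ / 2) * (Complex.I * b * Real.sqrt (ρ / 2)) =
      -((a * b / 2 : ℂ) * ρ) := by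
    linear_combination (a * b * ((Real.sqrt (ρ / 2) : ℝ) : ℂ) ^ 2) * Complex.I_sq - a * b * hs
  rw [h2]
  simp only [ENNReal.toReal_inv, ENNReal.toReal_ofNat, Complex.real_smul, Complex.ofReal_inv,
    Complex.ofReal_ofNat]
  ring

lemma integrable_mul_LagFun0 {d : ℕ} {σ : (Fin d → ℝ) → ℂ} (hσ : IsSPlus σ) (k : Fin d → ℕ) :
    IntegrableOn (fun ρ => σ ρ * (LagFun0 k ρ : ℂ)) (Rpos d) := by
  refine Integrable.mono' (hσ.integrableOn.norm.mul_const (∏ l, (3 : ℝ) ^ k l))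
    (hσ.aestronglyMeasurable.mul
      (Complex.continuous_ofReal.comp (continuous_LagFun0 k)).aestronglyMeasurable) ?_
  refine (ae_restrict_iff' (measurableSet_Rpos d)).2 (Eventually.of_forall fun ρ hρ => ?_)
  rw [norm_mul, Complex.norm_real, Real.norm_eq_abs, LagFun0, Finset.abs_prod]
  gcongr with l
  exact abs_lagFun0_le (k l) (hρ l).le

lemma integral_norm_mul_LagFun0_le {d : ℕ} {σ : (Fin d → ℝ) → ℂ} (hσ : IsSPlus σ)
    (k : Fin d → ℕ) :
    ∫ ρ in Rpos d, ‖σ ρ * (LagFun0 k ρ : ℂ)‖ ≤ (∏ l, (3 : ℝ) ^ k l) * ∫ ρ in Rpos d, ‖σ ρ‖ := by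
  rw [← integral_const_mul]
  refine setIntegral_mono_on (integrable_mul_LagFun0 hσ k).norm
    (hσ.integrableOn.norm.const_mul _) (measurableSet_Rpos d) fun ρ hρ => ?_
  rw [norm_mul, Complex.norm_real, Real.norm_eq_abs, LagFun0, Finset.abs_prod, mul_comm]
  gcongr with l
  exact abs_lagFun0_le (k l) (hρ l).le

/-- Integrating a symbol against the Laguerre generating function. -/
lemma integral_mul_prod_tsum_lagFun0 {d : ℕ} {σ : (Fin d → ℝ) → ℂ} (hσ : IsSPlus σ)
    (t : Fin d → ℂ) :
    ∫ ρ in Rpos d, σ ρ * ∏ l, ∑' n : ℕ, t l ^ n / n.factorial * (lagFun0 n (ρ l) : ℂ) =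
      ∑' k : Fin d → ℕ, (∏ l, t l ^ k l / (k l).factorial) *
        ∫ ρ in Rpos d, σ ρ * (LagFun0 k ρ : ℂ) := by
  have hint : ∀ k : Fin d → ℕ, Integrable (fun ρ => (∏ l, t l ^ k l / (k l).factorial) *
      (σ ρ * (LagFun0 k ρ : ℂ))) (volume.restrict (Rpos d)) := fun k =>
    (integrable_mul_LagFun0 hσ k).const_mul _
  have hsum : Summable fun k : Fin d → ℕ => ∫ ρ in Rpos d,
      ‖(∏ l, t l ^ k l / (k l).factorial) * (σ ρ * (LagFun0 k ρ : ℂ))‖ := by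
    have h1 := (summable_norm_prod_and_tsum_prod (fun (l : Fin d) n => (3 * t l) ^ n / n.factorial)
      fun l => NormedSpace.norm_expSeries_div_summable (3 * t l)).1
    refine Summable.of_nonneg_of_le (fun k => by positivity) (fun k => ?_)
      (h1.mul_right (∫ ρ in Rpos d, ‖σ ρ‖))
    simp only [norm_mul _ (σ _ * _)]
    rw [integral_const_mul]
    refine (mul_le_mul_of_nonneg_left (integral_norm_mul_LagFun0_le hσ k)
      (norm_nonneg _)).trans (le_of_eq ?_)
    rw [← mul_assoc, norm_prod, norm_prod, ← Finset.prod_mul_distrib]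
    congr 1
    refine Finset.prod_congr rfl fun l _ => ?_
    simp only [norm_div, norm_pow, norm_mul, Complex.norm_ofNat, mul_pow]
    ring
  have h2 := integral_tsum_of_summable_integral_norm hint hsum
  simp only [integral_const_mul] at h2
  rw [h2]
  refine setIntegral_congr_fun (measurableSet_Rpos d) fun ρ hρ => ?_
  rw [← (summable_norm_prod_and_tsum_prod
    (fun l n => t l ^ n / n.factorial * (lagFun0 n (ρ l) : ℂ))
    fun l => summable_lagFun0_genFun (t l) (hρ l).le).2, ← tsum_mul_left]
  refine tsum_congr fun k => ?_
  rw [LagFun0, Complex.ofReal_prod, Finset.prod_mul_distrib]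
  ring

lemma weylForm_gaussWaveLp {d : ℕ} {σ σb : (Fin d → ℝ) → ℂ} (hσ : IsSPlus σ)
    (hext : ∀ x ∈ Rpos d, σb x = σ x) (hs : Integrable (phaseSymbol σb)) (α β : Fin d → ℝ) :
    weylForm hs (gaussWaveLp α) (gaussWaveLp β) =
      (((2 * Real.pi) ^ (-(d : ℝ) / 2) : ℝ) : ℂ) * (Real.pi : ℂ) ^ d *
        (∏ l, (Real.sqrt Real.pi * Complex.exp (-((α l : ℂ) ^ 2 + (β l : ℂ) ^ 2) / 4))) *
        ∑' k : Fin d → ℕ, (∏ l, (α l * β l / 2 : ℂ) ^ k l / (k l).factorial) *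
          ∫ ρ in Rpos d, σ ρ * (LagFun0 k ρ : ℂ) := by
  set K : ℂ := (((2 * Real.pi) ^ (-(d : ℝ) / 2) : ℝ) : ℂ) with hK
  have hWig : ∀ z : (Fin d → ℝ) × (Fin d → ℝ),
      Wig (gaussWaveLp α) (gaussWaveLp β) z.1 z.2 =
        K * ∏ l, waveWigner (α l) (β l) (z.1 l, z.2 l) := fun z => by
    rw [Wig_congr_ae (coeFn_gaussWaveLp α) (coeFn_gaussWaveLp β), Wig_gaussWavePi]
  have hmp := measurePreserving_radialMapPi d
  have hint := integrable_mul_Wig hs (gaussWaveLp α) (gaussWaveLp β)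
  have hint' := (hmp.integrable_comp hint.aestronglyMeasurable).2 hint
  simp only [Function.comp_def] at hint'
  rw [weylForm_apply, ← hmp.map_eq, integral_map hmp.measurable.aemeasurable
    (by rw [hmp.map_eq]; exact hint.aestronglyMeasurable), integral_prod _ hint']
  rw [← integral_mul_prod_tsum_lagFun0 hσ, ← integral_const_mul]
  refine setIntegral_congr_fun (measurableSet_Rpos d) fun ρ hρ => ?_
  simp only [hWig, phaseSymbol_radialMapPi σb hρ, hext ρ hρ]
  rw [integral_const_mul, integral_const_mul, angleMeasurePi]
  have h1 : ∫ θ : Fin d → ℝ, ∏ l, waveWigner (α l) (β l)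
      ((radialMapPi (ρ, θ)).1 l, (radialMapPi (ρ, θ)).2 l) ∂(Measure.pi fun _ => angleMeasure) =
      ∏ l, ∫ θ, waveWigner (α l) (β l) (radialMap (ρ l, θ)) ∂angleMeasure :=
    integral_fintype_prod_eq_prod (fun l θ => waveWigner (α l) (β l) (radialMap (ρ l, θ)))
  rw [h1, Finset.prod_congr rfl fun l _ => integral_waveWigner_radialMap (α l) (β l) (hρ l)]
  simp only [Finset.prod_mul_distrib, Finset.prod_const, Finset.card_univ, Fintype.card_fin]
  ring

lemma two_pi_rpow_neg_mul_pi_pow (d : ℕ) :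
    (((2 * Real.pi) ^ (-(d : ℝ) / 2) : ℝ) : ℂ) * (Real.pi : ℂ) ^ d =
      ((2 : ℂ) ^ d)⁻¹ * (((2 * Real.pi) ^ ((d : ℝ) / 2) : ℝ) : ℂ) := by
  have h : (2 * Real.pi) ^ (-(d : ℝ) / 2) * (2 * Real.pi) ^ d = (2 * Real.pi) ^ ((d : ℝ) / 2) := by
    rw [← Real.rpow_natCast, ← Real.rpow_add (by positivity)]
    congr 1
    ring
  rw [← h]
  push_cast
  rw [mul_pow]
  field_simp

/-- Diagonalization of the Weyl operator with radial symbol in the Hermite basis: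
`∫ σ̄(2(x²+ξ²)) W̃(f,g)(x,ξ) dx dξ = 2^{−d}(2π)^{d/2} ∑_k (−1)^{|k|} f_k g_k ∫ σ 𝓛_k`,
the series converging absolutely. -/
theorem stmt19 {d : ℕ} (σ σb : (Fin d → ℝ) → ℂ) (hσ : IsSPlus σ)
    (hσb : ContinuousOn σb {x | ∀ i, 0 ≤ x i}) (hext : ∀ x ∈ Rpos d, σb x = σ x)
    (f g : SchwartzMap (Fin d → ℝ) ℂ)
    (fc gc : (Fin d → ℕ) → ℂ)
    (hfc : ∀ k : Fin d → ℕ, fc k = ∫ x : Fin d → ℝ, f x * (HermFun k x : ℂ))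
    (hgc : ∀ k : Fin d → ℕ, gc k = ∫ x : Fin d → ℝ, g x * (HermFun k x : ℂ)) :
    Summable (fun k : Fin d → ℕ =>
      ‖(-1 : ℂ) ^ (∑ l, k l) * fc k * gc k *
        ∫ ρ in Rpos d, σ ρ * ((LagFun0 k ρ : ℝ) : ℂ)‖) ∧
    (∫ z : (Fin d → ℝ) × (Fin d → ℝ),
        σb (fun l => 2 * ((z.1 l)^2 + (z.2 l)^2)) * Wig (⇑f) (⇑g) z.1 z.2)
      = ((2:ℂ) ^ d)⁻¹ * (((2 * Real.pi) ^ ((d:ℝ)/2) : ℝ) : ℂ) *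
          ∑' k : Fin d → ℕ, (-1 : ℂ) ^ (∑ l, k l) * fc k * gc k *
            ∫ ρ in Rpos d, σ ρ * ((LagFun0 k ρ : ℝ) : ℂ) := by
  obtain ⟨M, -, hM⟩ := hσ.exists_bound_lagCoeff
  set c : ℂ := ((2:ℂ) ^ d)⁻¹ * (((2 * Real.pi) ^ ((d:ℝ)/2) : ℝ) : ℂ) with hc
  set a : (Fin d → ℕ) → ℂ := fun k =>
    (-1 : ℂ) ^ (∑ l, k l) * ∫ ρ in Rpos d, σ ρ * ((LagFun0 k ρ : ℝ) : ℂ) with ha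
  have haM : ∀ k, ‖a k‖ ≤ M := fun k => by simpa [ha] using hM k
  have hs := integrable_phaseSymbol hσ hσb hext
  have hforms : weylForm hs = c • diagForm haM := by
    refine bilin_eq_of_eq_gaussWaveLp (exists_norm_weylForm_le hs) ?_ fun α β => ?_
    · obtain ⟨C, hC⟩ := exists_norm_diagForm_le haM
      refine ⟨‖c‖ * C, fun F G => ?_⟩
      rw [LinearMap.smul_apply, LinearMap.smul_apply, norm_smul, mul_assoc]
      gcongr
      exact hC F G
    · rw [weylForm_gaussWaveLp hσ hext hs, two_pi_rpow_neg_mul_pi_pow, LinearMap.smul_apply,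
        LinearMap.smul_apply, diagForm_apply, smul_eq_mul, mul_assoc, ← hc, ← tsum_mul_left]
      congr 2
      ext k
      rw [← mul_assoc, ← inner_hermLp_gaussWaveLp_mul]
      simp only [ha]
      ring
  have hfL := f.memLp 2 volume
  have hgL := g.memLp 2 volume
  have hcoeff : ∀ (u : SchwartzMap (Fin d → ℝ) ℂ) (k : Fin d → ℕ),
      inner ℂ (hermLp k) ((u.memLp 2 volume).toLp _) = ∫ x, u x * (HermFun k x : ℂ) := by
    intro u k
    rw [inner_hermLp]
    refine integral_congr_ae ?_
    filter_upwards [(u.memLp 2 volume).coeFn_toLp] with x hx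
    rw [hx]
  have hterm : ∀ k, (-1 : ℂ) ^ (∑ l, k l) * fc k * gc k *
      ∫ ρ in Rpos d, σ ρ * ((LagFun0 k ρ : ℝ) : ℂ) =
      a k * inner ℂ (hermLp k) (hfL.toLp _) * inner ℂ (hermLp k) (hgL.toLp _) := by
    intro k
    rw [hcoeff, hcoeff, ← hfc, ← hgc]
    simp only [ha]
    ring
  simp only [hterm]
  refine ⟨summable_norm_diag haM _ _, ?_⟩
  have h := congrArg (fun T => T (hfL.toLp _) (hgL.toLp _)) hforms
  simp only [weylForm_apply, LinearMap.smul_apply, diagForm_apply, smul_eq_mul] at h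
  rw [← h]
  congr 1
  ext z
  rw [Wig_congr_ae hfL.coeFn_toLp hgL.coeFn_toLp]
  rfl
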